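/- arXiv:2501.06731 — 2 statements merged into one kernel-verified Lean document; each statement's English description precedes it below -/
import Mathlib

section
/- If n \ge 500 and \mathcal{F} \subseteq S_n is an intersecting family of permutations, then the diversity of \mathcal{F} is at most (n-3)(n-3)!, i.e., there exist i, j \in [n] such that the number of \sigma \in \mathcal{F} with \sigma(i) \ne j is at most (n-3)(n-3)!. -/
open Finset

/-- A `k`-uniform family `W` whose members are minimal transversals of a family of sets of size at
most `k` has at most `k ^ k` members. -/
theorem card_branching_le {α : Type*} [DecidableEq α] {k : ℕ} (M W : Finset (Finset α))
    (hM : ∀ S ∈ M, #S ≤ k) (hWk : ∀ T ∈ W, #T = k)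
    (hWM : ∀ T ∈ W, ∀ S ∈ M, ¬Disjoint T S)
    (hmin : ∀ T ∈ W, ∀ Y ⊂ T, ∃ S ∈ M, Disjoint Y S) :
    #W ≤ k ^ k := by
  have key : ∀ j, ∀ Y : Finset α, #Y + j = k → #{T ∈ W | Y ⊆ T} ≤ k ^ j := by
    intro j
    induction j with
    | zero =>
      intro Y hY
      rw [pow_zero, card_le_one]
      intro T hT T' hT'
      rw [mem_filter] at hT hT'
      rw [← eq_of_subset_of_card_le hT.2 (by rw [hWk T hT.1]; omega),
        ← eq_of_subset_of_card_le hT'.2 (by rw [hWk T' hT'.1]; omega)]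
    | succ j ih =>
      intro Y hY
      rcases eq_empty_or_nonempty {T ∈ W | Y ⊆ T} with he | ⟨T, hT⟩
      · simp [he]
      rw [mem_filter] at hT
      obtain ⟨S, hS, hYS⟩ := hmin T hT.1 Y (ssubset_of_subset_of_ne hT.2 (by
        rintro rfl; have := hWk _ hT.1; omega))
      have hsub : {T ∈ W | Y ⊆ T} ⊆ S.biUnion fun x => {T ∈ W | insert x Y ⊆ T} := by
        intro T hT
        rw [mem_filter] at hT
        obtain ⟨x, hxT, hxS⟩ := not_disjoint_iff.1 (hWM T hT.1 S hS)
        exact mem_biUnion.2 ⟨x, hxS, mem_filter.2 ⟨hT.1, insert_subset hxT hT.2⟩⟩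
      calc _ ≤ _ := card_le_card hsub
        _ ≤ ∑ x ∈ S, #{T ∈ W | insert x Y ⊆ T} := card_biUnion_le
        _ ≤ ∑ x ∈ S, k ^ j := sum_le_sum fun x hx => ih _ (by
            rw [card_insert_of_notMem (disjoint_right.1 hYS hx)]; omega)
        _ ≤ k ^ (j + 1) := by
            rw [sum_const, smul_eq_mul, pow_succ']
            exact Nat.mul_le_mul_right _ (hM S hS)
  simpa using key k ∅ (by simp)

/-- An intersecting family of sets of size at most `k + 1` is refined by an intersecting family of
sets of size at most `k` together with few sets of size `k + 1`. -/
theorem exists_peeling {α : Type*} [Fintype α] [DecidableEq α] {k : ℕ} (𝒮 : Finset (Finset α))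
    (hk : ∀ S ∈ 𝒮, #S ≤ k + 1) (hint : ∀ S ∈ 𝒮, ∀ T ∈ 𝒮, ¬Disjoint S T) :
    ∃ 𝒮' W : Finset (Finset α), (∀ S ∈ 𝒮', #S ≤ k) ∧ (∀ S ∈ 𝒮', ∀ T ∈ 𝒮', ¬Disjoint S T) ∧
      (∀ T ∈ W, #T = k + 1) ∧ #W ≤ (k + 1) ^ (k + 1) ∧
      ∀ S ∈ 𝒮, (∃ T ∈ 𝒮', T ⊆ S) ∨ ∃ T ∈ W, T ⊆ S := by
  obtain ⟨M, hSM, ⟨hMk, hMint⟩, hMmax⟩ := (Set.toFinite {M : Finset (Finset α) |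
    (∀ S ∈ M, #S ≤ k + 1) ∧ ∀ S ∈ M, ∀ T ∈ M, ¬Disjoint S T}).exists_le_maximal
    (a := 𝒮) ⟨hk, hint⟩
  have hmem : ∀ T ∈ M, ∀ Y ⊆ T, (∀ S ∈ M, ¬Disjoint Y S) → Y ∈ M := by
    intro T hT Y hYT hY
    refine hMmax (y := insert Y M) ⟨?_, ?_⟩ (subset_insert Y M) (mem_insert_self Y M)
    · intro S hS
      rcases mem_insert.1 hS with rfl | hS
      · exact (card_le_card hYT).trans (hMk T hT)
      · exact hMk S hS
    · have hYY : ¬Disjoint Y Y := fun h => hY T hT (by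
        rw [disjoint_self] at h; subst h; exact disjoint_bot_left)
      intro S hS T hT
      rcases mem_insert.1 hS with hS' | hS' <;> rcases mem_insert.1 hT with hT' | hT'
      · rwa [hS', hT']
      · rw [hS']; exact hY T hT'
      · rw [hT']; exact fun h => hY S hS' h.symm
      · exact hMint S hS' T hT'
  refine ⟨{T ∈ M | #T ≤ k}, {T ∈ M | #T = k + 1 ∧ ∀ Y ∈ M, ¬Y ⊂ T}, ?_, ?_, ?_, ?_, ?_⟩
  · intro S hS; exact (mem_filter.1 hS).2
  · intro S hS T hT; exact hMint S (mem_filter.1 hS).1 T (mem_filter.1 hT).1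
  · intro T hT; exact (mem_filter.1 hT).2.1
  · apply card_branching_le M _ hMk
    · intro T hT; exact (mem_filter.1 hT).2.1
    · intro T hT S hS; exact hMint T (mem_filter.1 hT).1 S hS
    · intro T hT Y hY
      rw [mem_filter] at hT
      by_contra! h
      exact hT.2.2 Y (hmem T hT.1 Y hY.subset h) hY
  · intro S hS
    have hS := hSM hS
    by_cases hc : #S ≤ k
    · exact .inl ⟨S, mem_filter.2 ⟨hS, hc⟩, subset_rfl⟩
    have hc' : #S = k + 1 := by have := hMk S hS; omega
    by_cases h : ∃ Y ∈ M, Y ⊂ S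
    · obtain ⟨Y, hY, hYS⟩ := h
      exact .inl ⟨Y, mem_filter.2 ⟨hY, by have := card_lt_card hYS; omega⟩, hYS.subset⟩
    · push Not at h
      exact .inr ⟨S, mem_filter.2 ⟨hS, hc', h⟩, subset_rfl⟩

theorem exists_common_or_triangle {α : Type*} [DecidableEq α] (x₀ : α) (𝒮 : Finset (Finset α))
    (hk : ∀ S ∈ 𝒮, #S ≤ 2) (hint : ∀ S ∈ 𝒮, ∀ T ∈ 𝒮, ¬Disjoint S T) :
    (∃ x, ∀ S ∈ 𝒮, x ∈ S) ∨ ∃ a b c : α, a ≠ b ∧ b ≠ c ∧ a ≠ c ∧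
      ∀ S ∈ 𝒮, (a ∈ S ∧ b ∈ S) ∨ (b ∈ S ∧ c ∈ S) ∨ (a ∈ S ∧ c ∈ S) := by
  by_cases hcom : ∃ x, ∀ S ∈ 𝒮, x ∈ S
  · exact .inl hcom
  right
  push Not at hcom
  have hpair : ∀ S ∈ 𝒮, ∀ x ∈ S, ∃ y, y ≠ x ∧ S = {x, y} := by
    intro S hS x hx
    obtain ⟨T, hT, hxT⟩ := hcom x
    obtain ⟨y, hyS, hyT⟩ := not_disjoint_iff.1 (hint S hS T hT)
    have hyx : y ≠ x := by rintro rfl; exact hxT hyT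
    refine ⟨y, hyx, (eq_of_subset_of_card_le (s := {x, y}) ?_ ?_).symm⟩
    · simp [insert_subset_iff, hx, hyS]
    · rw [card_pair hyx.symm]; exact hk S hS
  obtain ⟨S₁, hS₁, -⟩ := hcom x₀
  obtain ⟨a, ha, -⟩ := not_disjoint_iff.1 (hint S₁ hS₁ S₁ hS₁)
  obtain ⟨b, hba, rfl⟩ := hpair S₁ hS₁ a ha
  obtain ⟨S₂, hS₂, haS₂⟩ := hcom a
  have hb : b ∈ S₂ := by
    have := hint _ hS₁ S₂ hS₂
    simp only [disjoint_insert_left, disjoint_singleton_left] at this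
    tauto
  obtain ⟨c, hcb, rfl⟩ := hpair S₂ hS₂ b hb
  obtain ⟨S₃, hS₃, hbS₃⟩ := hcom b
  have h₁ := hint _ hS₁ S₃ hS₃
  have h₂ := hint _ hS₂ S₃ hS₃
  simp only [disjoint_insert_left, disjoint_singleton_left] at h₁ h₂
  have hac : a ≠ c := by rintro rfl; simp at haS₂
  have ha₃ : a ∈ S₃ := by tauto
  have hc₃ : c ∈ S₃ := by tauto
  have hS₃' : S₃ = {a, c} := (eq_of_subset_of_card_le (by simp [insert_subset_iff, ha₃, hc₃])
    (by rw [card_pair hac]; exact hk _ hS₃)).symm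
  refine ⟨a, b, c, hba.symm, hcb.symm, hac, fun S hS => ?_⟩
  have k₁ := hint _ hS₁ S hS
  have k₂ := hint _ hS₂ S hS
  have k₃ := hint _ hS₃ S hS
  rw [hS₃'] at k₃
  simp only [disjoint_insert_left, disjoint_singleton_left] at k₁ k₂ k₃
  tauto

theorem two_mul_card_filter_mem_half {m : ℕ} (hm : 1 ≤ m) (x : Fin (2 * m)) :
    2 * (#{w ∈ powersetCard m (univ : Finset (Fin (2 * m))) | x ∈ w} : ℝ) =
      #(powersetCard m (univ : Finset (Fin (2 * m)))) := by
  obtain ⟨m, rfl⟩ : ∃ k, m = k + 1 := ⟨m - 1, by omega⟩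
  have h := card_filter_powersetCard_subset {x} (univ : Finset (Fin (2 * (m + 1)))) (m + 1)
    (by simp) (by simp)
  simp only [singleton_subset_iff, card_singleton, card_univ, Fintype.card_fin] at h
  rw [h, card_powersetCard, card_univ, Fintype.card_fin]
  have h' := Nat.add_one_mul_choose_eq (2 * m + 1) m
  rw [show 2 * (m + 1) - 1 = 2 * m + 1 by omega, show 2 * (m + 1) = 2 * m + 1 + 1 by ring,
    Nat.add_sub_cancel]
  have : (m + 1) * (2 * (2 * m + 1).choose m) = (m + 1) * (2 * m + 1 + 1).choose (m + 1) := by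
    rw [mul_comm (m + 1) (Nat.choose _ _), ← h']; ring
  exact_mod_cast Nat.eq_of_mul_eq_mul_left (by omega) this

theorem card_filter_mem_mem_half {m : ℕ} (hm : 2 ≤ m) {x y : Fin (2 * m)} (hxy : x ≠ y) :
    4 * (#{w ∈ powersetCard m (univ : Finset (Fin (2 * m))) | x ∈ w ∧ y ∈ w} : ℝ) =
      (2 * m - 2) / (2 * m - 1) * #(powersetCard m (univ : Finset (Fin (2 * m)))) := by
  rw [← two_mul_card_filter_mem_half (by omega) x]
  obtain ⟨m, rfl⟩ : ∃ k, m = k + 2 := ⟨m - 2, by omega⟩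
  have h := card_filter_powersetCard_subset {x} (univ : Finset (Fin (2 * (m + 2)))) (m + 2)
    (by simp) (by simp)
  have h' := card_filter_powersetCard_subset {x, y} (univ : Finset (Fin (2 * (m + 2)))) (m + 2)
    (by simp) (by simp [card_pair hxy])
  simp only [singleton_subset_iff, card_singleton, card_univ, Fintype.card_fin, card_pair hxy,
    insert_subset_iff, Nat.add_sub_cancel] at h h'
  rw [h, h', show 2 * (m + 2) - 1 = 2 * m + 2 + 1 by omega, show m + 2 - 1 = m + 1 by omega,
    show 2 * (m + 2) - 2 = 2 * m + 2 by omega]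
  have h'' := Nat.add_one_mul_choose_eq (2 * m + 2) m
  have h3 : ((2 * m + 2 + 1 : ℕ) : ℝ) * ((2 * m + 2).choose m : ℕ) =
    ((2 * m + 2 + 1).choose (m + 1) : ℕ) * ((m + 1 : ℕ) : ℝ) := by exact_mod_cast h''
  push_cast at h3 ⊢
  have hm0 : (0 : ℝ) ≤ m := Nat.cast_nonneg m
  have : (2 * ((m : ℝ) + 2) - 1) ≠ 0 := by linarith
  field_simp
  linarith

/-- Second moment estimate for random boxes `∏ i, ω i`, where the `ω i` are independent uniform
members of `Ω`, a family in which each point has density `1 / 2` and any two points have joint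
density `z / 4`. -/
theorem card_lt_two_mul_card_hit {α ι β : Type*} [Fintype ι] [DecidableEq ι] [DecidableEq β]
    (Ω : Finset (Finset β)) (hΩ : Ω.Nonempty) (z : ℝ)
    (h₁ : ∀ x, 2 * (#{w ∈ Ω | x ∈ w} : ℝ) = #Ω)
    (h₂ : ∀ x y, x ≠ y → 4 * (#{w ∈ Ω | x ∈ w ∧ y ∈ w} : ℝ) = z * #Ω)
    (A : Finset α) (f : α → ι → β)
    (hA : ∑ a ∈ A, ∑ b ∈ A, ∏ i, (if f a i = f b i then 2 else z) < 2 * (#A : ℝ) ^ 2) :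
    #(Fintype.piFinset fun _ : ι => Ω) <
      2 * #{ω ∈ Fintype.piFinset fun _ : ι => Ω | ∃ a ∈ A, ∀ i, f a i ∈ ω i} := by
  set P := Fintype.piFinset fun _ : ι => Ω with hP
  set G := {ω ∈ P | ∃ a ∈ A, ∀ i, f a i ∈ ω i} with hG
  set X : (ι → Finset β) → ℝ := fun ω => ∑ a ∈ A, if ∀ i, f a i ∈ ω i then 1 else 0 with hX
  have hΩ0 : (0 : ℝ) < #Ω := by exact_mod_cast hΩ.card_pos
  have hcount : ∀ (q : ι → Finset β → Prop) [∀ i, DecidablePred (q i)],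
      (∑ ω ∈ P, if ∀ i, q i (ω i) then (1 : ℝ) else 0) = ∏ i, (#{w ∈ Ω | q i w} : ℝ) := by
    intro q _
    rw [sum_boole, ← Nat.cast_prod, ← Fintype.card_piFinset]
    congr 2
    ext ω
    simp [hP, Fintype.mem_piFinset, forall_and]
  have hout : ∀ ω ∈ P, ω ∉ G → X ω = 0 := by
    intro ω hω hωG
    refine sum_eq_zero fun a ha => if_neg fun h => hωG ?_
    exact mem_filter.2 ⟨hω, a, ha, h⟩
  have hsum : ∑ ω ∈ G, X ω = #A * (#Ω / 2 : ℝ) ^ Fintype.card ι := by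
    rw [sum_subset (filter_subset _ _) hout, sum_comm,
      sum_congr rfl fun a _ => hcount fun i w => f a i ∈ w]
    rw [sum_congr rfl fun a _ => prod_congr rfl fun i _ =>
      (show (#{w ∈ Ω | f a i ∈ w} : ℝ) = #Ω / 2 by linarith [h₁ (f a i)])]
    simp [div_pow]
  have hsq : ∑ ω ∈ G, X ω ^ 2 = (#Ω / 4 : ℝ) ^ Fintype.card ι *
      ∑ a ∈ A, ∑ b ∈ A, ∏ i, (if f a i = f b i then 2 else z) := by
    rw [sum_subset (filter_subset _ _) fun ω hω h => by rw [hout ω hω h]; simp]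
    simp only [hX, sq, sum_mul_sum, ite_zero_mul_ite_zero, one_mul, ← forall_and]
    rw [sum_comm, mul_sum]
    refine sum_congr rfl fun a _ => ?_
    rw [sum_comm, mul_sum]
    refine sum_congr rfl fun b _ => ?_
    rw [hcount fun i w => f a i ∈ w ∧ f b i ∈ w, Fintype.card, ← prod_const, ← prod_mul_distrib]
    refine prod_congr rfl fun i _ => ?_
    split_ifs with h
    · simp only [h, and_self]
      linarith [h₁ (f b i)]
    · linarith [h₂ _ _ h]
  have hcs := sq_sum_le_card_mul_sum_sq (s := G) (f := X)
  rw [hsum, hsq] at hcs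
  have hPcard : (#P : ℝ) = (#Ω : ℝ) ^ Fintype.card ι := by simp [hP]
  have hA0 : 0 < (#A : ℝ) ^ 2 := by
    by_contra! h
    have : #A = 0 := by
      have h0 : (#A : ℝ) ^ 2 = 0 := le_antisymm h (sq_nonneg _)
      exact_mod_cast pow_eq_zero_iff (two_ne_zero) |>.1 h0
    rw [card_eq_zero] at this
    subst this
    simp at hA
  set S := ∑ a ∈ A, ∑ b ∈ A, ∏ i, (if f a i = f b i then 2 else z)
  set N := Fintype.card ι
  have hw : (0 : ℝ) < (#Ω / 4 : ℝ) ^ N := by positivity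
  have hkey : (#A : ℝ) ^ 2 * #P ≤ #G * S := by
    refine le_of_mul_le_mul_left ?_ hw
    calc _ = (#A * (#Ω / 2 : ℝ) ^ N) ^ 2 := by
          rw [hPcard, mul_pow, ← pow_mul, mul_comm N 2, pow_mul, mul_left_comm, ← mul_pow]
          congr 2; ring
      _ ≤ _ := hcs
      _ = _ := by ring
  by_contra! hcon
  have hcon' : 2 * (#G : ℝ) ≤ #P := by exact_mod_cast hcon
  have hPpos : (0 : ℝ) < #P := by rw [hPcard]; positivity
  have hGpos : (0 : ℝ) < #G := by
    rcases (Nat.cast_nonneg #G : (0 : ℝ) ≤ #G).eq_or_lt with h | h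
    · rw [← h] at hkey; nlinarith
    · exact h
  nlinarith

/-- The members of `A` whose graph contains `U`. -/
def link {n : ℕ} (A : Finset (Equiv.Perm (Fin n))) (U : Finset (Fin n × Fin n)) :
    Finset (Equiv.Perm (Fin n)) :=
  {σ ∈ A | ∀ p ∈ U, σ p.1 = p.2}

section link

variable {n : ℕ} {A : Finset (Equiv.Perm (Fin n))} {U V : Finset (Fin n × Fin n)}
  {σ : Equiv.Perm (Fin n)}

theorem mem_link : σ ∈ link A U ↔ σ ∈ A ∧ ∀ p ∈ U, σ p.1 = p.2 := by
  simp [link]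

theorem link_subset : link A U ⊆ A := filter_subset _ _

theorem link_link (h : U ⊆ V) : link (link A U) V = link A V := by
  ext σ
  simp only [mem_link]
  exact ⟨fun h' => ⟨h'.1.1, h'.2⟩, fun h' => ⟨⟨h'.1, fun p hp => h'.2 p (h hp)⟩, h'.2⟩⟩

theorem card_image_fst (h : ∀ p ∈ U, σ p.1 = p.2) : #(U.image Prod.fst) = #U := by
  refine card_image_of_injOn fun p hp q hq hpq => Prod.ext hpq ?_
  rw [← h p hp, ← h q hq]
  exact congrArg σ hpq

theorem card_link_univ_of_mem (h : ∀ p ∈ U, σ p.1 = p.2) :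
    #(link univ U) = (n - #U).factorial := by
  have e := Fintype.card_congr (Equiv.Perm.subtypeEquivSubtypePerm (fun i => i ∉ U.image Prod.fst))
  rw [Fintype.card_perm, Fintype.card_subtype, filter_not, Fintype.card_subtype] at e
  rw [filter_mem_eq_inter, univ_inter, card_sdiff_of_subset (subset_univ _), card_image_fst h,
    card_univ, Fintype.card_fin] at e
  rw [e]
  refine card_nbij' (σ⁻¹ * ·) (σ * ·) ?_ ?_ ?_ ?_
  · intro τ hτ
    simp only [mem_coe, mem_link, mem_univ, true_and] at hτ
    simp only [coe_filter, mem_univ, true_and, not_not, mem_image, Set.mem_ofPred_eq]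
    rintro _ ⟨p, hp, rfl⟩
    simp [hτ p hp, ← h p hp]
  · intro τ hτ
    simp only [coe_filter, mem_univ, true_and, not_not, mem_image, Set.mem_ofPred_eq] at hτ
    simp only [mem_coe, mem_link, mem_univ, true_and]
    intro p hp
    rw [Equiv.Perm.mul_apply, hτ p.1 ⟨p, hp, rfl⟩, h p hp]
  · intro τ _; simp
  · intro τ _; simp

theorem card_link_le : #(link A U) ≤ (n - #U).factorial := by
  rcases eq_empty_or_nonempty (link A U) with h | ⟨σ, hσ⟩
  · simp [h]
  rw [← card_link_univ_of_mem (mem_link.1 hσ).2]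
  exact card_le_card (filter_subset_filter _ (subset_univ A))

end link

theorem factorial_le_three_mul_numDerangements {m : ℕ} (hm : 4 ≤ m) :
    m.factorial + 1 ≤ 3 * numDerangements m := by
  induction m, hm using Nat.le_induction with
  | base => decide
  | succ m hm ih =>
    have h := numDerangements_succ m
    have h1 : (-1 : ℤ) ^ m ≤ 1 := by
      rcases neg_one_pow_eq_or ℤ m with h | h <;> simp [h]
    rw [Nat.factorial_succ]
    zify at ih ⊢
    rw [h]
    nlinarith

/-- Many permutations through two compatible points avoid a given permutation. -/
theorem exists_many_disjoint {n : ℕ} (hn : 6 ≤ n) (π τ : Equiv.Perm (Fin n)) {b c : Fin n × Fin n}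
    (hbc : b ≠ c) (hb : τ b.1 = b.2) (hc : τ c.1 = c.2) (hπb : π b.1 ≠ b.2) (hπc : π c.1 ≠ c.2) :
    (n - 2).factorial ≤ 3 * #{σ ∈ link univ {b, c} | ∀ i, σ i ≠ π i} := by
  classical
  obtain ⟨i, j⟩ := b
  obtain ⟨k, l⟩ := c
  simp only at hb hc hπb hπc
  have hik : i ≠ k := by rintro rfl; exact hbc (by rw [← hb, ← hc])
  have hjl : j ≠ l := by rw [← hb, ← hc]; exact τ.injective.ne hik
  obtain ⟨ρ, hρi, hρk, hρ⟩ : ∃ ρ : Equiv.Perm (Fin n), ρ i = j ∧ ρ k = l ∧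
      ∀ x, x ≠ i → x ≠ k → π x ≠ j → π x ≠ l → ρ x = π x := by
    have h1 : (Equiv.swap j (π i) * π) i = j := by simp
    have h2 : (Equiv.swap j (π i) * π) k ≠ j := by
      exact fun h => hik.symm ((Equiv.injective _) (h.trans h1.symm))
    refine ⟨Equiv.swap l ((Equiv.swap j (π i) * π) k) * (Equiv.swap j (π i) * π), ?_, ?_, ?_⟩
    · rw [Equiv.Perm.mul_apply, h1, Equiv.swap_apply_of_ne_of_ne hjl h2.symm]
    · rw [Equiv.Perm.mul_apply, Equiv.swap_apply_right]
    · intro x hxi hxk hxj hxl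
      have hx : (Equiv.swap j (π i) * π) x = π x := by
        rw [Equiv.Perm.mul_apply, Equiv.swap_apply_of_ne_of_ne hxj (π.injective.ne hxi)]
      have hx' : (Equiv.swap j (π i) * π) x ≠ (Equiv.swap j (π i) * π) k :=
        (Equiv.injective _).ne hxk
      rw [Equiv.Perm.mul_apply, Equiv.swap_apply_of_ne_of_ne (by rwa [hx]) hx', hx]
  have hD : #{f : Equiv.Perm (Fin n) | ∀ a, ¬(a ≠ i ∧ a ≠ k) ↔ a ∈ Function.fixedPoints f} =
      numDerangements (n - 2) := by
    rw [← Fintype.card_subtype,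
      ← Fintype.card_congr (derangements.subtypeEquiv fun a => a ≠ i ∧ a ≠ k),
      card_derangements_eq_numDerangements, Fintype.card_subtype]
    congr 1
    have : ({x | x ≠ i ∧ x ≠ k} : Finset (Fin n)) = univ \ {i, k} := by ext; simp
    rw [this, card_sdiff_of_subset (subset_univ _), card_pair hik, card_univ, Fintype.card_fin]
  have := factorial_le_three_mul_numDerangements (m := n - 2) (by omega)
  rw [← hD] at this
  refine (Nat.le_of_succ_le this).trans (Nat.mul_le_mul_left 3 ?_)
  refine card_le_card_of_injOn (ρ * ·) ?_ (mul_right_injective ρ).injOn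
  intro f hf
  simp only [coe_filter, mem_univ, true_and, Set.mem_ofPred_eq, Function.mem_fixedPoints,
    Function.IsFixedPt] at hf
  have hfi : f i = i := (hf i).1 (by tauto)
  have hfk : f k = k := (hf k).1 (by tauto)
  simp only [coe_filter, Set.mem_ofPred_eq, mem_link, mem_univ, true_and, mem_insert,
    mem_singleton, forall_eq_or_imp, forall_eq, Equiv.Perm.mul_apply, hfi, hfk, hρi, hρk]
  intro x hx
  by_cases hxi : x = i
  · subst hxi; rw [hfi, hρi] at hx; exact hπb hx.symm
  by_cases hxk : x = k
  · subst hxk; rw [hfk, hρk] at hx; exact hπc hx.symm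
  have hfx : f x ≠ x := fun h => (hf x).2 h ⟨hxi, hxk⟩
  have h1 : π x ≠ j := by
    rw [← hx, ← hρi, ← hfi]; simpa [hfi] using f.injective.ne hxi
  have h2 : π x ≠ l := by
    rw [← hx, ← hρk, ← hfk]; simpa [hfk] using f.injective.ne hxk
  exact hfx (ρ.injective (hx.trans (hρ x hxi hxk h1 h2).symm))

/-- `A` is a nonempty family of permutations through `S` whose density in the permutations through
`S` grows by a factor of at most `4 / 3` for each further prescribed value. -/
structure IsSpread {n : ℕ} (A : Finset (Equiv.Perm (Fin n))) (S : Finset (Fin n × Fin n)) :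
    Prop where
  nonempty : A.Nonempty
  apply_eq : ∀ σ ∈ A, ∀ p ∈ S, σ p.1 = p.2
  card_link_mul_le : ∀ U, S ⊆ U → (#(link A U) : ℝ) * ((n - #S).factorial * (4 / 3) ^ #S) ≤
    #A * ((n - #U).factorial * (4 / 3) ^ #U)

/-- Every nonempty family of permutations has a spread link, at a set that is small unless the
family is. -/
theorem exists_isSpread_link {n : ℕ} {A : Finset (Equiv.Perm (Fin n))} (hA : A.Nonempty) :
    ∃ S, IsSpread (link A S) S ∧ (#A : ℝ) * (4 / 3) ^ #S ≤ n.factorial := by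
  set v : Finset (Fin n × Fin n) → ℝ := fun U => (n - #U).factorial * (4 / 3) ^ #U with hv
  have hvpos : ∀ U, 0 < v U := fun U => by positivity
  obtain ⟨S, hS⟩ := Finite.exists_max fun U => (#(link A U) : ℝ) / v U
  have h0 := hS ∅
  have hlink : link A ∅ = A := by ext; simp [mem_link]
  have hv0 : v ∅ = n.factorial := by simp [hv]
  rw [hlink, div_le_div_iff₀ (hvpos _) (hvpos _), hv0] at h0
  have hApos : (0 : ℝ) < #A := by exact_mod_cast hA.card_pos
  refine ⟨S, ⟨?_, fun σ hσ => (mem_link.1 hσ).2, fun U hSU => ?_⟩, ?_⟩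
  · rw [← card_pos]
    by_contra! h
    have h' : #(link A S) = 0 := by omega
    rw [h', Nat.cast_zero, zero_mul] at h0
    exact absurd h0 (not_le.2 (mul_pos hApos (hvpos S)))
  · have := hS U
    rw [link_link hSU]
    rwa [div_le_div_iff₀ (hvpos _) (hvpos _)] at this
  · have hle : (#(link A S) : ℝ) ≤ (n - #S).factorial := by exact_mod_cast card_link_le
    have hf : (0 : ℝ) < (n - #S).factorial := by positivity
    refine le_of_mul_le_mul_left ?_ hf
    calc _ = #A * v S := by simp only [hv]; ring
      _ ≤ _ := h0
      _ ≤ _ := by gcongr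

theorem five_hundred_mul_sq_le {s : ℕ} (hs : 51 ≤ s) : (500 : ℝ) * s ^ 2 ≤ (4 / 3) ^ s := by
  induction s, hs using Nat.le_induction with
  | base => norm_num
  | succ s hs ih =>
    have : (51 : ℝ) ≤ s := by exact_mod_cast hs
    push_cast
    calc (500 : ℝ) * (s + 1) ^ 2 ≤ 500 * s ^ 2 * (4 / 3) := by nlinarith
      _ ≤ (4 / 3) ^ s * (4 / 3) := by gcongr
      _ = _ := (pow_succ _ _).symm

theorem ten_mul_le_of_factorial_lt {n s a : ℕ} (hn : 500 ≤ n) (ha : (n - 2).factorial < 5 * a)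
    (h : (a : ℝ) * (4 / 3) ^ s ≤ n.factorial) : 10 * s ≤ n := by
  by_contra! hs
  have h1 := five_hundred_mul_sq_le (s := s) (by omega)
  obtain ⟨k, rfl⟩ : ∃ k, n = k + 2 := ⟨n - 2, by omega⟩
  rw [Nat.add_sub_cancel] at ha
  rw [show (k + 2).factorial = (k + 1 + 1) * ((k + 1) * k.factorial) from rfl] at h
  have ha' : (k.factorial : ℝ) < 5 * a := by exact_mod_cast ha
  have hf : (0 : ℝ) < k.factorial := by positivity
  have hs' : ((k : ℝ) + 2) < 10 * s := by exact_mod_cast hs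
  have hk : (0 : ℝ) ≤ k := Nat.cast_nonneg k
  push_cast at h
  have h2 : (k.factorial : ℝ) * (500 * s ^ 2) < 5 * ((k + 1 + 1) * ((k + 1) * k.factorial)) := by
    calc (k.factorial : ℝ) * (500 * s ^ 2) ≤ k.factorial * (4 / 3) ^ s := by gcongr
      _ < 5 * a * (4 / 3) ^ s := by gcongr
      _ ≤ _ := by linarith
  have h3 : (500 * (s : ℝ) ^ 2) < 5 * ((k + 1 + 1) * (k + 1)) := by
    refine lt_of_mul_lt_mul_left ?_ hf.le
    linarith
  have h4 := mul_self_lt_mul_self (by linarith) hs'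
  linarith

theorem descFactorial_mul_pow_le {r N : ℕ} (h : r ≤ N) (k : ℕ) :
    r.descFactorial k * N ^ k ≤ r ^ k * N.descFactorial k := by
  induction k with
  | zero => simp
  | succ k ih =>
    have hstep : (r - k) * N ≤ r * (N - k) := by
      rw [Nat.sub_mul, Nat.mul_sub]
      have := Nat.mul_le_mul_right k h
      rw [mul_comm k N]
      omega
    rw [Nat.descFactorial_succ, Nat.descFactorial_succ]
    calc (r - k) * r.descFactorial k * N ^ (k + 1)
        = (r.descFactorial k * N ^ k) * ((r - k) * N) := by ring
      _ ≤ (r ^ k * N.descFactorial k) * (r * (N - k)) := Nat.mul_le_mul ih hstep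
      _ = _ := by ring

theorem choose_mul_factorial_div_le {r N k : ℕ} (hrN : r ≤ N) (hk : k ≤ r) :
    (r.choose k : ℝ) * ((N - k).factorial / N.factorial) ≤ ((r : ℝ) / N) ^ k / k.factorial := by
  rcases Nat.eq_zero_or_pos N with rfl | hN
  · obtain rfl : r = 0 := by omega
    obtain rfl : k = 0 := by omega
    simp
  have h1 := descFactorial_mul_pow_le hrN k
  have h2 := Nat.factorial_mul_descFactorial (hk.trans hrN)
  rw [Nat.descFactorial_eq_factorial_mul_choose] at h1
  have hN' : (0 : ℝ) < (N : ℝ) ^ k := by positivity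
  rw [div_pow, div_div, mul_div_assoc', div_le_div_iff₀ (by positivity) (by positivity)]
  have h1' : (k.factorial : ℝ) * r.choose k * N ^ k ≤ r ^ k * N.descFactorial k := by
    exact_mod_cast h1
  have h2' : ((N - k).factorial : ℝ) * N.descFactorial k = N.factorial := by exact_mod_cast h2
  rw [← h2']
  have hf : (0 : ℝ) ≤ (N - k).factorial := by positivity
  nlinarith [mul_le_mul_of_nonneg_left h1' hf]

theorem sum_choose_mul_le_exp {r N : ℕ} (hrN : r ≤ N) {x : ℝ} (hx : 0 ≤ x) :
    ∑ k ∈ range (r + 1), (r.choose k : ℝ) * (x ^ k * ((N - k).factorial / N.factorial)) ≤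
      Real.exp (x * (r / N)) := by
  refine le_trans (sum_le_sum fun k hk => ?_) (Real.sum_le_exp_of_nonneg (by positivity) (r + 1))
  have := choose_mul_factorial_div_le hrN (Nat.lt_succ_iff.1 (mem_range.1 hk))
  rw [mul_left_comm, mul_pow, mul_div_assoc]
  gcongr

theorem pow_mul_exp_lt {n m N r : ℕ} (hn : 500 ≤ n) (hm : 2 * m ≤ n + 1) (hnm : n ≤ 2 * m)
    (hN : 9 * n ≤ 10 * N) (hNn : N ≤ n) (hrN : r ≤ N) :
    ((2 * m - 2) / (2 * m - 1) : ℝ) ^ r * Real.exp (m / (m - 1) * (4 / 3) * (r / N)) < 17 / 10 := by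
  have hn' : (500 : ℝ) ≤ n := by exact_mod_cast hn
  have hm' : 2 * (m : ℝ) ≤ n + 1 := by exact_mod_cast hm
  have hnm' : (n : ℝ) ≤ 2 * m := by exact_mod_cast hnm
  have hN' : 9 * (n : ℝ) ≤ 10 * N := by exact_mod_cast hN
  have hNn' : (N : ℝ) ≤ n := by exact_mod_cast hNn
  have hrN' : (r : ℝ) ≤ N := by exact_mod_cast hrN
  have hN0 : (0 : ℝ) < N := by linarith
  have hw : (m / (m - 1) : ℝ) ≤ 250 / 249 := by
    rw [div_le_div_iff₀ (by linarith) (by norm_num)]; linarith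
  have hw1 : 1 ≤ (m / (m - 1) : ℝ) := by
    rw [one_le_div (by linarith)]; linarith
  have hz : ((2 * m - 2) / (2 * m - 1) : ℝ) ≤ Real.exp (-(1 / n)) := by
    refine le_trans ?_ (Real.add_one_le_exp _)
    have : (1 / n : ℝ) ≤ 1 / (2 * m - 1) := one_div_le_one_div_of_le (by linarith) (by linarith)
    have h2 : ((2 * m - 2) / (2 * m - 1) : ℝ) = 1 - 1 / (2 * m - 1) := by
      have : (2 * m - 1 : ℝ) ≠ 0 := by linarith
      field_simp
      ring
    linarith
  have hz0 : (0 : ℝ) ≤ (2 * m - 2) / (2 * m - 1) := div_nonneg (by linarith) (by linarith)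
  have hexp : -(1 / n : ℝ) * r + m / (m - 1) * (4 / 3) * (r / N) ≤ 1 / 2 := by
    have h1 : (1 / n : ℝ) ≤ 1 / N := one_div_le_one_div_of_le hN0 hNn'
    have h2 : (9 / 10 : ℝ) * (1 / N) ≤ 1 / n := by
      rw [mul_one_div, div_le_div_iff₀ hN0 (by linarith)]; linarith
    have h3 : -(1 / n : ℝ) * r + m / (m - 1) * (4 / 3) * (r / N) ≤
        (r / N : ℝ) * (250 / 249 * (4 / 3) - 9 / 10) := by
      have h4 : (9 / 10 : ℝ) * (r / N) ≤ 1 / n * r := by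
        have := mul_le_mul_of_nonneg_right h2 (Nat.cast_nonneg r : (0 : ℝ) ≤ r)
        calc _ = 9 / 10 * (1 / N : ℝ) * r := by ring
          _ ≤ _ := this
      have h5 : (m / (m - 1) : ℝ) * (4 / 3) * (r / N) ≤ 250 / 249 * (4 / 3) * (r / N) := by gcongr
      linarith
    have h6 : (r / N : ℝ) ≤ 1 := (div_le_one hN0).2 hrN'
    have h7 : (0 : ℝ) ≤ r / N := by positivity
    linarith
  calc _ ≤ Real.exp (-(1 / n)) ^ r * Real.exp (m / (m - 1) * (4 / 3) * (r / N)) := by gcongr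
    _ = Real.exp (-(1 / n) * r + m / (m - 1) * (4 / 3) * (r / N)) := by
        rw [Real.exp_add, mul_comm (-(1 / (n : ℝ))) (r : ℝ), Real.exp_nat_mul]
    _ ≤ Real.exp (1 / 2) := Real.exp_le_exp.2 hexp
    _ < 17 / 10 := by
        refine lt_of_pow_lt_pow_left₀ 2 (by norm_num) ?_
        rw [← Real.exp_nat_mul]
        norm_num
        linarith [Real.exp_one_lt_d9]

namespace IsSpread

variable {n : ℕ} {A : Finset (Equiv.Perm (Fin n))} {S T V : Finset (Fin n × Fin n)}

theorem card_image_fst (hA : IsSpread A S) : #(S.image Prod.fst) = #S := by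
  obtain ⟨σ, hσ⟩ := hA.nonempty
  exact _root_.card_image_fst (hA.apply_eq σ hσ)

theorem card_link_le (hA : IsSpread A S) (hSV : S ⊆ V) {k : ℕ} (hV : #V = #S + k) :
    (#(link A V) : ℝ) ≤ #A * ((4 / 3) ^ k * ((n - #S - k).factorial / (n - #S).factorial)) := by
  have h := hA.card_link_mul_le V hSV
  rw [hV, ← Nat.sub_sub, pow_add] at h
  have hf : (0 : ℝ) < (n - #S).factorial := by positivity
  have hp : (0 : ℝ) < (4 / 3) ^ #S := by positivity
  rw [mul_div_assoc', mul_div_assoc', le_div_iff₀ hf]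
  refine le_of_mul_le_mul_right ?_ hp
  linarith

theorem seventeen_mul_card_le (hA : IsSpread A S) (hn : 500 ≤ n) (hST : Disjoint S T)
    (hS : 10 * #S ≤ n) (hT : 10 * #T ≤ n) :
    17 * (#A : ℝ) ≤ 20 * #{σ ∈ A | ∀ p ∈ T, σ p.1 ≠ p.2} := by
  classical
  have hcover : A ⊆ {σ ∈ A | ∀ p ∈ T, σ p.1 ≠ p.2} ∪ T.biUnion fun p => link A (insert p S) := by
    intro σ hσ
    by_cases h : ∀ p ∈ T, σ p.1 ≠ p.2
    · exact mem_union_left _ (mem_filter.2 ⟨hσ, h⟩)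
    · push Not at h
      obtain ⟨p, hp, hpσ⟩ := h
      refine mem_union_right _ (mem_biUnion.2 ⟨p, hp, mem_link.2 ⟨hσ, ?_⟩⟩)
      simp only [forall_mem_insert]
      exact ⟨hpσ, hA.apply_eq σ hσ⟩
  have hcard : (#A : ℝ) ≤ #{σ ∈ A | ∀ p ∈ T, σ p.1 ≠ p.2} +
      ∑ p ∈ T, (#(link A (insert p S)) : ℝ) := by
    exact_mod_cast (card_le_card hcover).trans ((card_union_le _ _).trans
      (Nat.add_le_add_left card_biUnion_le _))
  have hS' : 10 * (#S : ℝ) ≤ n := by exact_mod_cast hS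
  have hT' : 10 * (#T : ℝ) ≤ n := by exact_mod_cast hT
  have hn' : (500 : ℝ) ≤ n := by exact_mod_cast hn
  have hlink : ∀ p ∈ T, (#(link A (insert p S)) : ℝ) ≤ #A * (4 / 3 * (10 / (9 * n))) := by
    intro p hp
    have hpS : p ∉ S := fun h => disjoint_left.1 hST h hp
    refine (hA.card_link_le (subset_insert p S) (card_insert_of_notMem hpS)).trans ?_
    obtain ⟨N, hN⟩ : ∃ N, n - #S = N + 1 := ⟨n - #S - 1, by omega⟩
    have hN' : (n : ℝ) - #S = N + 1 := by
      rw [← Nat.cast_sub (by omega), hN]; push_cast; rfl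
    rw [hN, Nat.add_sub_cancel, Nat.factorial_succ, pow_one]
    have hf : (0 : ℝ) < N.factorial := by positivity
    have : (N.factorial : ℝ) / ((N + 1) * N.factorial : ℕ) ≤ 10 / (9 * n) := by
      push_cast
      rw [div_le_div_iff₀ (by positivity) (by positivity)]
      nlinarith
    gcongr
  have hsum := sum_le_sum hlink
  rw [sum_const, nsmul_eq_mul] at hsum
  have : (#T : ℝ) * (#A * (4 / 3 * (10 / (9 * n)))) ≤ 4 / 27 * #A := by
    have h : (#T : ℝ) * (10 / (9 * n)) ≤ 1 / 9 := by
      rw [mul_div_assoc', div_le_div_iff₀ (by positivity) (by norm_num)]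
      linarith
    calc _ = (#T : ℝ) * (10 / (9 * n)) * (4 / 3 * #A) := by ring
      _ ≤ 1 / 9 * (4 / 3 * #A) := by gcongr
      _ = _ := by ring
  have hA0 : (0 : ℝ) ≤ #A := Nat.cast_nonneg _
  linarith

theorem sum_prod_ite_le (hA : IsSpread A S) {D : Finset (Fin n)} (hD : S.image Prod.fst ⊆ D)
    (σ : Equiv.Perm (Fin n)) {z w : ℝ} (hz : 0 ≤ z) (hw : 0 ≤ w) (hzw : z * (1 + w) = 2) :
    ∑ τ ∈ A, ∏ i : {i // i ∉ D}, (if σ i = τ i then 2 else z) ≤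
      #A * (z ^ (n - #D) * ∑ k ∈ range (n - #D + 1), ((n - #D).choose k : ℝ) *
        ((w * (4 / 3)) ^ k * ((n - #S - k).factorial / (n - #S).factorial))) := by
  classical
  have hr : #(univ : Finset {i // i ∉ D}) = n - #D := by
    rw [card_univ, Fintype.card_subtype_compl, Fintype.card_fin, Fintype.card_coe]
  have hprod : ∀ τ : Equiv.Perm (Fin n), ∏ i : {i // i ∉ D}, (if σ i = τ i then 2 else z) =
      z ^ (n - #D) * ∑ U ∈ (univ : Finset {i // i ∉ D}).powerset,
        w ^ #U * if ∀ i ∈ U, σ i = τ i then 1 else 0 := by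
    intro τ
    rw [← hr, ← prod_const]
    have : ∀ U ∈ (univ : Finset {i // i ∉ D}).powerset,
        (w ^ #U * if ∀ i ∈ U, σ i = τ i then 1 else 0) =
          ∏ i ∈ U, if σ i = τ i then w else 0 := by
      intro U _
      rw [prod_ite_zero, prod_const]
      split_ifs <;> simp
    rw [sum_congr rfl this, ← prod_one_add, ← prod_mul_distrib]
    refine prod_congr rfl fun i _ => ?_
    split_ifs <;> simp [hzw]
  have hcount : ∀ U : Finset {i // i ∉ D}, (#{τ ∈ A | ∀ i ∈ U, σ i = τ i} : ℝ) ≤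
      #A * ((4 / 3) ^ #U * ((n - #S - #U).factorial / (n - #S).factorial)) := by
    intro U
    have hdisj : Disjoint S (U.image fun i : {i // i ∉ D} => ((i : Fin n), σ i)) := by
      rw [disjoint_left]
      rintro p hp hpU
      obtain ⟨i, -, rfl⟩ := mem_image.1 hpU
      exact i.2 (hD (mem_image.2 ⟨_, hp, rfl⟩))
    have hinj : Function.Injective fun i : {i // i ∉ D} => ((i : Fin n), σ i) :=
      fun i j h => Subtype.ext (congrArg Prod.fst h)
    refine le_trans ?_ (hA.card_link_le
      (V := S ∪ U.image fun i : {i // i ∉ D} => ((i : Fin n), σ i)) subset_union_left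
      (by rw [card_union_of_disjoint hdisj, card_image_of_injective _ hinj]))
    refine Nat.cast_le.2 (card_le_card fun τ hτ => ?_)
    rw [mem_filter] at hτ
    rw [mem_link]
    refine ⟨hτ.1, fun p hp => ?_⟩
    rcases mem_union.1 hp with hp | hp
    · exact hA.apply_eq τ hτ.1 p hp
    · obtain ⟨i, hi, rfl⟩ := mem_image.1 hp
      exact (hτ.2 i hi).symm
  rw [sum_congr rfl fun τ _ => hprod τ, ← mul_sum, sum_comm, mul_left_comm]
  refine mul_le_mul_of_nonneg_left ?_ (pow_nonneg hz _)
  calc _ = ∑ U ∈ (univ : Finset {i // i ∉ D}).powerset,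
        w ^ #U * (#{τ ∈ A | ∀ i ∈ U, σ i = τ i} : ℝ) := by
        refine sum_congr rfl fun U _ => ?_
        rw [← mul_sum, sum_boole]
    _ ≤ ∑ U ∈ (univ : Finset {i // i ∉ D}).powerset,
        w ^ #U * (#A * ((4 / 3) ^ #U * ((n - #S - #U).factorial / (n - #S).factorial))) := by
        gcongr
        exact hcount _
    _ = _ := by
        rw [sum_powerset_apply_card fun k => w ^ k * (#A * ((4 / 3) ^ k *
          ((n - #S - k).factorial / (n - #S).factorial) : ℝ)), hr, mul_sum]
        refine sum_congr rfl fun k _ => ?_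
        rw [nsmul_eq_mul, mul_pow]
        ring

/-- More than half of the random boxes contain a member of a spread family that avoids a small set
of points. -/
theorem card_lt_two_mul_card_hit (hA : IsSpread A S) (hn : 500 ≤ n) (hST : Disjoint S T)
    (hS : 10 * #S ≤ n) (hT : 10 * #T ≤ n) {D : Finset (Fin n)} (hD : S.image Prod.fst ⊆ D)
    {m : ℕ} (hm : 2 * m ≤ n + 1) (hnm : n ≤ 2 * m) {e : Fin n → Fin (2 * m)}
    (he : Function.Injective e) :
    #(Fintype.piFinset fun _ : {i // i ∉ D} => powersetCard m (univ : Finset (Fin (2 * m)))) <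
      2 * #{ω ∈ Fintype.piFinset fun _ : {i // i ∉ D} =>
        powersetCard m (univ : Finset (Fin (2 * m))) |
          ∃ σ ∈ A, (∀ p ∈ T, σ p.1 ≠ p.2) ∧ ∀ i : {i // i ∉ D}, e (σ i) ∈ ω i} := by
  classical
  have hm' : (250 : ℝ) ≤ m := by exact_mod_cast (by omega : 250 ≤ m)
  set z : ℝ := (2 * m - 2) / (2 * m - 1) with hz
  have hz0 : 0 ≤ z := div_nonneg (by linarith) (by linarith)
  have hw0 : (0 : ℝ) ≤ m / (m - 1) := div_nonneg (by linarith) (by linarith)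
  have hzw : z * (1 + m / (m - 1)) = 2 := by
    have h1 : (2 * m - 1 : ℝ) ≠ 0 := by linarith
    have h2 : (m - 1 : ℝ) ≠ 0 := by linarith
    rw [hz]
    field_simp
    ring
  set A' := {σ ∈ A | ∀ p ∈ T, σ p.1 ≠ p.2} with hA'
  have hDcard : #S ≤ #D := hA.card_image_fst ▸ card_le_card hD
  have hA'A := hA.seventeen_mul_card_le hn hST hS hT
  have hA0 : (0 : ℝ) < #A := by exact_mod_cast hA.nonempty.card_pos
  have hA'0 : (0 : ℝ) < #A' := by rw [← hA'] at hA'A; linarith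
  have hpt : ∀ σ ∈ A', ∑ τ ∈ A', ∏ i : {i // i ∉ D},
      (if e (σ i) = e (τ i) then 2 else z) < #A * (17 / 10) := by
    intro σ _
    simp only [he.eq_iff]
    calc _ ≤ ∑ τ ∈ A, ∏ i : {i // i ∉ D}, (if σ i = τ i then 2 else z) := by
          refine sum_le_sum_of_subset_of_nonneg (filter_subset _ _) fun τ _ _ => ?_
          exact prod_nonneg fun i _ => by split_ifs <;> linarith
      _ ≤ _ := hA.sum_prod_ite_le hD σ hz0 hw0 hzw
      _ < _ := by
          refine mul_lt_mul_of_pos_left ?_ hA0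
          refine lt_of_le_of_lt (mul_le_mul_of_nonneg_left (sum_choose_mul_le_exp (by omega)
            (by positivity)) (pow_nonneg hz0 _)) ?_
          exact pow_mul_exp_lt hn hm hnm (by omega) (by omega) (by omega)
  have hmain : ∑ σ ∈ A', ∑ τ ∈ A', ∏ i : {i // i ∉ D},
      (if e (σ i) = e (τ i) then 2 else z) < 2 * (#A' : ℝ) ^ 2 := by
    refine (sum_lt_sum_of_nonempty (card_pos.1 (by exact_mod_cast hA'0)) hpt).trans_le ?_
    rw [sum_const, nsmul_eq_mul]
    nlinarith
  have := _root_.card_lt_two_mul_card_hit (powersetCard m (univ : Finset (Fin (2 * m))))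
    (powersetCard_nonempty.2 (by simp; omega)) z (two_mul_card_filter_mem_half (by omega))
    (fun x y hxy => card_filter_mem_mem_half (by omega) hxy) A'
    (fun σ (i : {i // i ∉ D}) => e (σ i)) hmain
  simpa only [hA', mem_filter, and_assoc] using this

end IsSpread

theorem IsSpread.not_disjoint {n : ℕ} {A B : Finset (Equiv.Perm (Fin n))}
    {S T : Finset (Fin n × Fin n)} (hA : IsSpread A S) (hB : IsSpread B T) (hn : 500 ≤ n)
    (hS : 10 * #S ≤ n) (hT : 10 * #T ≤ n) (hAB : ∀ σ ∈ A, ∀ π ∈ B, ∃ i, σ i = π i) :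
    ¬Disjoint S T := by
  classical
  intro hST
  obtain ⟨m, hm, hnm⟩ : ∃ m, 2 * m ≤ n + 1 ∧ n ≤ 2 * m := ⟨(n + 1) / 2, by omega, by omega⟩
  have hA' := hA.card_lt_two_mul_card_hit hn hST hS hT
    (D := S.image Prod.fst ∪ T.image Prod.fst) subset_union_left hm hnm (Fin.castLE_injective hnm)
  have hB' := hB.card_lt_two_mul_card_hit hn hST.symm hT hS
    (D := S.image Prod.fst ∪ T.image Prod.fst) subset_union_right hm hnm (Fin.castLE_injective hnm)
  set D := S.image Prod.fst ∪ T.image Prod.fst with hD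
  set P := Fintype.piFinset fun _ : {i // i ∉ D} => powersetCard m (univ : Finset (Fin (2 * m)))
    with hP
  set GA := {ω ∈ P | ∃ σ ∈ A, (∀ p ∈ T, σ p.1 ≠ p.2) ∧
    ∀ i : {i // i ∉ D}, Fin.castLE hnm (σ i) ∈ ω i}
  set GB := {ω ∈ P | ∃ σ ∈ B, (∀ p ∈ S, σ p.1 ≠ p.2) ∧
    ∀ i : {i // i ∉ D}, Fin.castLE hnm (σ i) ∈ ω i}
  have hdisj : Disjoint GA (GB.image compl) := by
    rw [disjoint_left]
    intro ω hω hω'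
    obtain ⟨ω', hωB, rfl⟩ := mem_image.1 hω'
    obtain ⟨-, σ, hσA, hσT, hσ⟩ := mem_filter.1 hω
    obtain ⟨-, π, hπB, hπS, hπ⟩ := mem_filter.1 hωB
    obtain ⟨i, hi⟩ := hAB σ hσA π hπB
    by_cases hiD : i ∈ D
    · rcases mem_union.1 hiD with h | h
      · obtain ⟨p, hp, rfl⟩ := mem_image.1 h
        exact hπS p hp (hi.symm.trans (hA.apply_eq σ hσA p hp))
      · obtain ⟨p, hp, rfl⟩ := mem_image.1 h
        exact hσT p hp (hi.trans (hB.apply_eq π hπB p hp))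
    · have h1 := hσ ⟨i, hiD⟩
      have h2 := hπ ⟨i, hiD⟩
      simp only [Pi.compl_apply, mem_compl] at h1
      exact h1 (by rwa [hi])
  have hsub : GA ∪ GB.image compl ⊆ P := by
    refine union_subset (filter_subset _ _) (image_subset_iff.2 fun ω hω => ?_)
    have h := (mem_filter.1 hω).1
    rw [hP, Fintype.mem_piFinset] at h ⊢
    intro i
    have hi := (mem_powersetCard.1 (h i)).2
    rw [mem_powersetCard, Pi.compl_apply, card_compl, hi, Fintype.card_fin]
    exact ⟨subset_univ _, by omega⟩
  have hcard := card_le_card hsub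
  rw [card_union_of_disjoint hdisj, card_image_of_injective _ compl_injective] at hcard
  omega

/-- The members of `F` whose graph contains no member of `𝒮`. -/
def uncovered {n : ℕ} (F : Finset (Equiv.Perm (Fin n))) (𝒮 : Finset (Finset (Fin n × Fin n))) :
    Finset (Equiv.Perm (Fin n)) :=
  {σ ∈ F | ∀ S ∈ 𝒮, ∃ p ∈ S, σ p.1 ≠ p.2}

section uncovered

variable {n : ℕ} {F : Finset (Equiv.Perm (Fin n))}

theorem mem_uncovered {𝒮 : Finset (Finset (Fin n × Fin n))} {σ : Equiv.Perm (Fin n)} :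
    σ ∈ uncovered F 𝒮 ↔ σ ∈ F ∧ ∀ S ∈ 𝒮, ∃ p ∈ S, σ p.1 ≠ p.2 := by
  simp [uncovered]

/-- Outside few exceptions, the members of an intersecting family of permutations are covered by an
intersecting family of small sets of points. -/
theorem exists_intersecting_cover (hn : 500 ≤ n) (hint : ∀ σ ∈ F, ∀ π ∈ F, ∃ i, σ i = π i) :
    ∃ 𝒮 : Finset (Finset (Fin n × Fin n)), (∀ S ∈ 𝒮, #S ≤ n / 10) ∧
      (∀ S ∈ 𝒮, ∀ T ∈ 𝒮, ¬Disjoint S T) ∧ 5 * #(uncovered F 𝒮) ≤ (n - 2).factorial := by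
  classical
  set 𝒮 : Finset (Finset (Fin n × Fin n)) := {S | 10 * #S ≤ n ∧ ∃ A ⊆ F, IsSpread A S}
  refine ⟨𝒮, ?_, ?_, ?_⟩
  · intro S hS
    have := (mem_filter.1 hS).2.1
    omega
  · intro S hS T hT
    obtain ⟨-, hS, A, hAF, hA⟩ := mem_filter.1 hS
    obtain ⟨-, hT, B, hBF, hB⟩ := mem_filter.1 hT
    exact hA.not_disjoint hB hn hS hT fun σ hσ π hπ => hint σ (hAF hσ) π (hBF hπ)
  · by_contra! h
    have hne : (uncovered F 𝒮).Nonempty := card_pos.1 (by omega)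
    obtain ⟨S, hS, hcard⟩ := exists_isSpread_link hne
    have hS𝒮 : S ∈ 𝒮 := mem_filter.2 ⟨mem_univ _, ten_mul_le_of_factorial_lt hn h hcard,
      _, link_subset.trans (filter_subset _ _), hS⟩
    obtain ⟨σ, hσ⟩ := hS.nonempty
    obtain ⟨p, hp, hpσ⟩ := (mem_uncovered.1 (mem_link.1 hσ).1).2 S hS𝒮
    exact hpσ ((mem_link.1 hσ).2 p hp)

theorem exists_cover_card_le_two {k : ℕ} (hk : 2 ≤ k) (𝒮 : Finset (Finset (Fin n × Fin n)))
    (h𝒮 : ∀ S ∈ 𝒮, #S ≤ k) (hint : ∀ S ∈ 𝒮, ∀ T ∈ 𝒮, ¬Disjoint S T) :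
    ∃ 𝒮' : Finset (Finset (Fin n × Fin n)), (∀ S ∈ 𝒮', #S ≤ 2) ∧
      (∀ S ∈ 𝒮', ∀ T ∈ 𝒮', ¬Disjoint S T) ∧ #(uncovered F 𝒮') ≤
        #(uncovered F 𝒮) + ∑ j ∈ Ico 2 k, (j + 1) ^ (j + 1) * (n - (j + 1)).factorial := by
  classical
  induction k, hk using Nat.le_induction generalizing 𝒮 with
  | base => exact ⟨𝒮, h𝒮, hint, by simp⟩
  | succ k hk ih =>
    obtain ⟨𝒯, W, h𝒯, h𝒯int, hW, hWcard, hcover⟩ := exists_peeling 𝒮 h𝒮 hint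
    obtain ⟨𝒮', h1, h2, h3⟩ := ih 𝒯 h𝒯 h𝒯int
    refine ⟨𝒮', h1, h2, h3.trans ?_⟩
    rw [sum_Ico_succ_top hk, ← add_assoc, add_right_comm]
    refine Nat.add_le_add_right ?_ _
    have hsub : uncovered F 𝒯 ⊆ uncovered F 𝒮 ∪ W.biUnion (link F) := by
      intro σ hσ
      rw [mem_uncovered] at hσ
      by_contra hσ'
      simp only [mem_union, mem_uncovered, mem_biUnion, mem_link, hσ.1, true_and] at hσ'
      push Not at hσ'
      obtain ⟨⟨S, hS, hσS⟩, hσW⟩ := hσ'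
      rcases hcover S hS with ⟨T, hT, hTS⟩ | ⟨T, hT, hTS⟩
      · obtain ⟨p, hp, hpσ⟩ := hσ.2 T hT
        exact hpσ (hσS p (hTS hp))
      · obtain ⟨p, hp, hpσ⟩ := hσW T hT
        exact hpσ (hσS p (hTS hp))
    refine (card_le_card hsub).trans ((card_union_le _ _).trans (Nat.add_le_add_left ?_ _))
    refine card_biUnion_le.trans ((sum_le_card_nsmul W _ (n - (k + 1)).factorial ?_).trans ?_)
    · intro T hT
      exact hW T hT ▸ card_link_le
    · exact Nat.mul_le_mul_right _ hWcard

end uncovered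

theorem add_one_pow_le_three_mul_pow (k : ℕ) : (k + 1) ^ k ≤ 3 * k ^ k := by
  rcases Nat.eq_zero_or_pos k with rfl | hk
  · norm_num
  have hk' : (0 : ℝ) < k := by exact_mod_cast hk
  have h : (1 + 1 / (k : ℝ)) ^ k ≤ 3 := by
    calc (1 + 1 / (k : ℝ)) ^ k ≤ Real.exp (1 / k) ^ k := by
          gcongr
          linarith [Real.add_one_le_exp (1 / (k : ℝ))]
      _ = Real.exp 1 := by
          rw [← Real.exp_nat_mul, mul_one_div_cancel hk'.ne']
      _ ≤ 3 := by linarith [Real.exp_one_lt_d9]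
  have : ((k : ℝ) + 1) ^ k = (1 + 1 / (k : ℝ)) ^ k * k ^ k := by
    rw [← mul_pow]
    congr 1
    field_simp
  have h' : ((k : ℝ) + 1) ^ k ≤ 3 * k ^ k := by
    rw [this]
    gcongr
  exact_mod_cast h'

theorem two_mul_sum_pow_mul_factorial_le {n k : ℕ} (hk : 3 ≤ k) (hkn : 10 * k ≤ n) :
    2 * ∑ j ∈ Ico 2 k, (j + 1) ^ (j + 1) * (n - (j + 1)).factorial +
      k ^ k * (n - k).factorial ≤ 81 * (n - 3).factorial := by
  induction k, hk using Nat.le_induction with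
  | base => simp; omega
  | succ k hk ih =>
    refine le_trans ?_ (ih (by omega))
    rw [sum_Ico_succ_top (by omega)]
    have hstep : 3 * ((k + 1) ^ (k + 1) * (n - (k + 1)).factorial) ≤
        k ^ k * (n - k).factorial := by
      obtain ⟨N, hN⟩ : ∃ N, n - k = N + 1 := ⟨n - k - 1, by omega⟩
      rw [show n - (k + 1) = N by omega, hN, Nat.factorial_succ, pow_succ]
      calc 3 * ((k + 1) ^ k * (k + 1) * N.factorial)
          ≤ 3 * (3 * k ^ k * (k + 1) * N.factorial) := by
            gcongr
            exact add_one_pow_le_three_mul_pow k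
        _ = k ^ k * (9 * (k + 1) * N.factorial) := by ring
        _ ≤ _ := by
            gcongr
            omega
    omega

theorem card_filter_ne_le_of_avoiding {n : ℕ} (hn : 500 ≤ n) {F U : Finset (Equiv.Perm (Fin n))}
    (hint : ∀ σ ∈ F, ∀ π ∈ F, ∃ i, σ i = π i)
    (hU : 10 * #U ≤ 2 * (n - 2).factorial + 405 * (n - 3).factorial) {a b c : Fin n × Fin n}
    (hbc : b ≠ c) (hF : ∀ σ ∈ F, σ ∉ U → σ a.1 ≠ a.2 → σ b.1 = b.2 ∧ σ c.1 = c.2)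
    {π : Equiv.Perm (Fin n)} (hπ : π ∈ F) (hπb : π b.1 ≠ b.2) (hπc : π c.1 ≠ c.2) :
    #{σ ∈ F | σ a.1 ≠ a.2} ≤ (n - 3) * (n - 3).factorial := by
  classical
  have hsub : {σ ∈ F | σ a.1 ≠ a.2} ⊆ U ∪ link F {b, c} := by
    intro σ hσ
    rw [mem_filter] at hσ
    by_cases hσU : σ ∈ U
    · exact mem_union_left _ hσU
    · refine mem_union_right _ (mem_link.2 ⟨hσ.1, ?_⟩)
      simpa using hF σ hσ.1 hσU hσ.2
  have hlink : 3 * #(link F {b, c}) ≤ 2 * (n - 2).factorial := by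
    rcases eq_empty_or_nonempty (link F {b, c}) with h | ⟨τ, hτ⟩
    · simp [h]
    have hτ' := (mem_link.1 hτ).2
    have hmany := exists_many_disjoint (by omega) π τ hbc (hτ' b (by simp)) (hτ' c (by simp))
      hπb hπc
    have hdisj : Disjoint (link F {b, c}) {σ ∈ link univ {b, c} | ∀ i, σ i ≠ π i} := by
      rw [disjoint_left]
      intro σ hσ hσ'
      obtain ⟨i, hi⟩ := hint σ (link_subset hσ) π hπ
      exact (mem_filter.1 hσ').2 i hi
    have hle : #(link F {b, c}) + #{σ ∈ link univ {b, c} | ∀ i, σ i ≠ π i} ≤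
        (n - 2).factorial := by
      rw [← card_union_of_disjoint hdisj, ← card_pair hbc, ← card_link_univ_of_mem hτ']
      exact card_le_card (union_subset (filter_subset_filter _ (subset_univ F))
        (filter_subset _ _))
    omega
  have hcard := (card_le_card hsub).trans (card_union_le _ _)
  obtain ⟨N, rfl⟩ : ∃ N, n = N + 3 := ⟨n - 3, by omega⟩
  rw [show N + 3 - 2 = N + 1 by omega, Nat.factorial_succ] at hU hlink
  rw [Nat.add_sub_cancel] at hU ⊢
  nlinarith [Nat.mul_le_mul_right N.factorial (show 497 ≤ N by omega)]

theorem card_filter_ne_le_of_two_of_three {n : ℕ} (hn : 3 ≤ n) {F : Finset (Equiv.Perm (Fin n))}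
    {a b c : Fin n × Fin n} {τ : Equiv.Perm (Fin n)} (hab : a ≠ b) (hac : a ≠ c) (hbc : b ≠ c)
    (hτ : τ a.1 = a.2 ∧ τ b.1 = b.2 ∧ τ c.1 = c.2)
    (hF : ∀ σ ∈ F, σ a.1 ≠ a.2 → σ b.1 = b.2 ∧ σ c.1 = c.2) :
    #{σ ∈ F | σ a.1 ≠ a.2} ≤ (n - 3) * (n - 3).factorial := by
  classical
  have hdisj : Disjoint {σ ∈ F | σ a.1 ≠ a.2} (link univ {a, b, c}) := by
    rw [disjoint_left]
    intro σ hσ hσ'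
    exact (mem_filter.1 hσ).2 ((mem_link.1 hσ').2 a (by simp))
  have hsub : {σ ∈ F | σ a.1 ≠ a.2} ∪ link univ {a, b, c} ⊆ link univ {b, c} := by
    intro σ hσ
    simp only [mem_union, mem_filter, mem_link, mem_univ, true_and, forall_mem_insert,
      mem_singleton, forall_eq] at hσ ⊢
    rcases hσ with hσ | hσ
    · exact hF σ hσ.1 hσ.2
    · exact hσ.2
  have hcard := card_le_card hsub
  rw [card_union_of_disjoint hdisj, card_link_univ_of_mem (σ := τ) (by simpa using hτ),
    card_link_univ_of_mem (σ := τ) (by simpa using hτ.2), card_pair hbc,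
    card_eq_three.2 ⟨a, b, c, hab, hac, hbc, rfl⟩] at hcard
  obtain ⟨N, rfl⟩ : ∃ N, n = N + 3 := ⟨n - 3, by omega⟩
  rw [show N + 3 - 2 = N + 1 by omega, Nat.factorial_succ] at hcard
  rw [Nat.add_sub_cancel] at hcard ⊢
  linarith

theorem exists_cover_card_le_two_of_intersecting {n : ℕ} (hn : 500 ≤ n)
    {F : Finset (Equiv.Perm (Fin n))} (hint : ∀ σ ∈ F, ∀ π ∈ F, ∃ i, σ i = π i) :
    ∃ 𝒮 : Finset (Finset (Fin n × Fin n)), (∀ S ∈ 𝒮, #S ≤ 2) ∧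
      (∀ S ∈ 𝒮, ∀ T ∈ 𝒮, ¬Disjoint S T) ∧
      10 * #(uncovered F 𝒮) ≤ 2 * (n - 2).factorial + 405 * (n - 3).factorial := by
  obtain ⟨𝒮, h1, h2, h3⟩ := exists_intersecting_cover hn hint
  obtain ⟨𝒮', h1', h2', h3'⟩ := exists_cover_card_le_two (F := F) (by omega) 𝒮 h1 h2
  have := two_mul_sum_pow_mul_factorial_le (n := n) (k := n / 10) (by omega) (by omega)
  exact ⟨𝒮', h1', h2', by omega⟩

theorem exists_perm_apply_eq {n : ℕ} {a b c : Fin n × Fin n} {σ : Equiv.Perm (Fin n)}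
    (hb : σ b.1 = b.2) (hc : σ c.1 = c.2) (hab₁ : a.1 ≠ b.1) (hac₁ : a.1 ≠ c.1)
    (hab₂ : a.2 ≠ b.2) (hac₂ : a.2 ≠ c.2) :
    ∃ τ : Equiv.Perm (Fin n), τ a.1 = a.2 ∧ τ b.1 = b.2 ∧ τ c.1 = c.2 := by
  refine ⟨Equiv.swap (σ a.1) a.2 * σ, by simp, ?_, ?_⟩
  · rw [Equiv.Perm.mul_apply, hb, Equiv.swap_apply_of_ne_of_ne _ hab₂.symm]
    exact hb ▸ σ.injective.ne hab₁.symm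
  · rw [Equiv.Perm.mul_apply, hc, Equiv.swap_apply_of_ne_of_ne _ hac₂.symm]
    exact hc ▸ σ.injective.ne hac₁.symm

theorem diversity_of_intersecting_permutation_family (n : ℕ) (hn : 500 ≤ n)
    (F : Finset (Equiv.Perm (Fin n)))
    (hint : ∀ σ ∈ F, ∀ π ∈ F, ∃ i : Fin n, σ i = π i) :
    ∃ i j : Fin n, (F.filter (fun σ => σ i ≠ j)).card ≤ (n - 3) * (n - 3).factorial := by
  obtain ⟨𝒮, hcard, h𝒮, hU⟩ := exists_cover_card_le_two_of_intersecting hn hint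
  have hcov : ∀ σ ∈ F, σ ∉ uncovered F 𝒮 → ∃ S ∈ 𝒮, ∀ p ∈ S, σ p.1 = p.2 := by
    intro σ hσ hσU
    rw [mem_uncovered] at hσU
    push Not at hσU
    exact hσU hσ
  have i₀ : Fin n := ⟨0, by omega⟩
  rcases exists_common_or_triangle (i₀, i₀) 𝒮 hcard h𝒮 with
    ⟨x, hx⟩ | ⟨a, b, c, hab, hbc, hac, htri⟩
  · refine ⟨x.1, x.2, (card_le_card (t := uncovered F 𝒮) fun σ hσ => ?_).trans ?_⟩
    · rw [mem_filter] at hσ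
      exact mem_uncovered.2 ⟨hσ.1, fun S hS => ⟨x, hx S hS, hσ.2⟩⟩
    · obtain ⟨N, rfl⟩ : ∃ N, n = N + 3 := ⟨n - 3, by omega⟩
      rw [show N + 3 - 2 = N + 1 by omega, Nat.factorial_succ] at hU
      rw [Nat.add_sub_cancel] at hU ⊢
      nlinarith [Nat.mul_le_mul_right N.factorial (show 497 ≤ N by omega)]
  have htwo : ∀ σ ∈ F, σ ∉ uncovered F 𝒮 → (σ a.1 = a.2 ∧ σ b.1 = b.2) ∨
      (σ b.1 = b.2 ∧ σ c.1 = c.2) ∨ (σ a.1 = a.2 ∧ σ c.1 = c.2) := by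
    intro σ hσ hσU
    obtain ⟨S, hS, hσS⟩ := hcov σ hσ hσU
    exact (htri S hS).imp (fun h => ⟨hσS _ h.1, hσS _ h.2⟩)
      (Or.imp (fun h => ⟨hσS _ h.1, hσS _ h.2⟩) fun h => ⟨hσS _ h.1, hσS _ h.2⟩)
  by_cases h₁ : ∃ π ∈ F, π b.1 ≠ b.2 ∧ π c.1 ≠ c.2
  · obtain ⟨π, hπ, hπb, hπc⟩ := h₁
    refine ⟨a.1, a.2,
      card_filter_ne_le_of_avoiding hn hint hU hbc (fun σ hσ hσU h => ?_) hπ hπb hπc⟩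
    have := htwo σ hσ hσU
    tauto
  by_cases h₂ : ∃ π ∈ F, π a.1 ≠ a.2 ∧ π c.1 ≠ c.2
  · obtain ⟨π, hπ, hπa, hπc⟩ := h₂
    refine ⟨b.1, b.2,
      card_filter_ne_le_of_avoiding hn hint hU hac (fun σ hσ hσU h => ?_) hπ hπa hπc⟩
    have := htwo σ hσ hσU
    tauto
  by_cases h₃ : ∃ π ∈ F, π a.1 ≠ a.2 ∧ π b.1 ≠ b.2
  · obtain ⟨π, hπ, hπa, hπb⟩ := h₃
    refine ⟨c.1, c.2,
      card_filter_ne_le_of_avoiding hn hint hU hab (fun σ hσ hσU h => ?_) hπ hπa hπb⟩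
    have := htwo σ hσ hσU
    tauto
  by_contra! hcon
  have hne : ∀ x : Fin n × Fin n, ∃ σ ∈ F, σ x.1 ≠ x.2 := fun x =>
    filter_nonempty_iff.1 (card_pos.1 ((Nat.zero_le _).trans_lt (hcon x.1 x.2)))
  push Not at h₁ h₂ h₃
  have hcompat : ∀ {x y : Fin n × Fin n} {σ : Equiv.Perm (Fin n)}, x ≠ y → σ x.1 = x.2 →
      σ y.1 = y.2 → x.1 ≠ y.1 ∧ x.2 ≠ y.2 := by
    intro x y σ hxy hx hy
    have h : x.1 ≠ y.1 := fun h => hxy (Prod.ext h (by rw [← hx, ← hy, h]))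
    exact ⟨h, by rw [← hx, ← hy]; exact σ.injective.ne h⟩
  obtain ⟨α, hαF, hα⟩ := hne a
  obtain ⟨β, hβF, hβ⟩ := hne b
  obtain ⟨γ, hγF, hγ⟩ := hne c
  have hαb : α b.1 = b.2 := by_contra fun h => h (h₃ α hαF hα)
  have hαc : α c.1 = c.2 := h₂ α hαF hα
  obtain ⟨hac₁, hac₂⟩ := hcompat hac (by_contra fun h => hβ (h₃ β hβF h)) (h₁ β hβF hβ)
  obtain ⟨hab₁, hab₂⟩ := hcompat hab (by_contra fun h => hγ (h₂ γ hγF h))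
    (by_contra fun h => hγ (h₁ γ hγF h))
  obtain ⟨τ, hτ⟩ := exists_perm_apply_eq hαb hαc hab₁ hac₁ hab₂ hac₂
  exact (hcon a.1 a.2).not_ge (card_filter_ne_le_of_two_of_three (by omega) hab hac hbc hτ
    fun σ hσ h => ⟨h₃ σ hσ h, h₂ σ hσ h⟩)
end

section
/- Let \mathcal{F} \subseteq \binom{[n]}{k} be an intersecting family of k-sets, and let r > 2^{2(1+H(\delta))}/\delta where \delta = 1/(2 log_2(2k)). Then \mathcal{F} is not r-spread; i.e., there exists a nonempty set A \subseteq [n] with |\mathcal{F}(A)| > r^{-|A|} |\mathcal{F}|. -/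
namespace SpreadFamily

variable {α ι : Type*} [DecidableEq α]

/-- The probability that a `p`-random subset of `s` equals `W`. -/
noncomputable def weight (p : ℝ) (s W : Finset α) : ℝ :=
  p ^ W.card * (1 - p) ^ (s \ W).card

/-- The expectation of `f` at a `p`-random subset of `s`. -/
noncomputable def expect (p : ℝ) (s : Finset α) (f : Finset α → ℝ) : ℝ :=
  ∑ W ∈ s.powerset, weight p s W * f W

lemma weight_nonneg {p : ℝ} (h0 : 0 ≤ p) (h1 : p ≤ 1) (s W : Finset α) : 0 ≤ weight p s W :=
  mul_nonneg (pow_nonneg h0 _) (pow_nonneg (sub_nonneg.2 h1) _)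

lemma expect_insert (p : ℝ) {a : α} {s : Finset α} (ha : a ∉ s) (f : Finset α → ℝ) :
    expect p (insert a s) f =
      (1 - p) * expect p s f + p * expect p s (fun W => f (insert a W)) := by
  unfold expect
  rw [Finset.sum_powerset_insert ha, Finset.mul_sum, Finset.mul_sum]
  congr 1
  · refine Finset.sum_congr rfl fun W hW => ?_
    have haW : a ∉ W := fun h => ha (Finset.mem_powerset.1 hW h)
    rw [weight, weight, Finset.insert_sdiff_of_notMem _ haW,
      Finset.card_insert_of_notMem (by simp [ha])]
    ring
  · refine Finset.sum_congr rfl fun W hW => ?_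
    have haW : a ∉ W := fun h => ha (Finset.mem_powerset.1 hW h)
    rw [weight, weight, Finset.insert_sdiff_insert, Finset.card_insert_of_notMem haW,
      Finset.sdiff_insert_of_notMem ha]
    ring

lemma expect_add (p : ℝ) (s : Finset α) (f g : Finset α → ℝ) :
    expect p s (fun W => f W + g W) = expect p s f + expect p s g := by
  simp [expect, mul_add, Finset.sum_add_distrib]

lemma expect_mul_left (p c : ℝ) (s : Finset α) (f : Finset α → ℝ) :
    expect p s (fun W => c * f W) = c * expect p s f := by
  simp [expect, Finset.mul_sum, mul_left_comm]

lemma expect_const (p c : ℝ) (s : Finset α) : expect p s (fun _ => c) = c := by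
  induction s using Finset.induction_on with
  | empty => simp [expect, weight]
  | insert a s ha ih => rw [expect_insert p ha, ih]; ring

lemma expect_mono {p : ℝ} (h0 : 0 ≤ p) (h1 : p ≤ 1) (s : Finset α) {f g : Finset α → ℝ}
    (h : ∀ W, f W ≤ g W) : expect p s f ≤ expect p s g :=
  Finset.sum_le_sum fun W _ => mul_le_mul_of_nonneg_left (h W) (weight_nonneg h0 h1 s W)

/-- The union of independent `p`-random and `q`-random sets is `1 - (1 - p) * (1 - q)`-random. -/
lemma expect_union (p q : ℝ) (s : Finset α) (f : Finset α → ℝ) :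
    expect p s (fun W => expect q s fun V => f (W ∪ V)) =
      expect (1 - (1 - p) * (1 - q)) s f := by
  induction s using Finset.induction_on generalizing f with
  | empty => simp [expect, weight]
  | insert a s ha ih =>
    simp only [expect_insert _ ha, expect_add, expect_mul_left, Finset.insert_union,
      Finset.union_insert, Finset.insert_idem, ih, ih fun W => f (insert a W)]
    ring

/-- A choice of a smallest member of the family `S` inside `Z` (empty if there is none). -/
lemma exists_smallest_member [Finite ι] (S : ι → Finset α) (Z : Finset α) :
    ∃ C : Finset α, ∀ i, S i ⊆ Z → (∃ j, C = S j) ∧ C ⊆ Z ∧ C.card ≤ (S i).card := by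
  classical
  have := Fintype.ofFinite ι
  by_cases h : ∃ i, S i ⊆ Z
  · obtain ⟨i, hi⟩ := h
    obtain ⟨j, hj, hmin⟩ := Finset.exists_min_image (Finset.univ.filter fun j => S j ⊆ Z)
      (fun j => (S j).card) ⟨i, by simpa using hi⟩
    simp only [Finset.mem_filter, Finset.mem_univ, true_and] at hj hmin
    exact ⟨S j, fun i hi => ⟨⟨j, rfl⟩, hj, hmin i hi⟩⟩
  · push Not at h
    exact ⟨∅, fun i hi => absurd hi (h i)⟩

/-- Minimum fragments: inside `S i ∪ W` one finds a member of the family, no larger than `S i`,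
whose part `T` outside `W` is contained in the chosen smallest member of `W ∪ T`. -/
lemma exists_min_fragment [Finite ι] (S : ι → Finset α) (C : Finset α → Finset α)
    (hC : ∀ Z i, S i ⊆ Z → (∃ j, C Z = S j) ∧ C Z ⊆ Z ∧ (C Z).card ≤ (S i).card)
    (W : Finset α) (i : ι) :
    ∃ T : Finset α, T ⊆ S i ∧ (∃ j, T = S j \ W) ∧ T ⊆ C (W ∪ T) ∧
      (C (W ∪ T)).card ≤ (S i).card := by
  classical
  have := Fintype.ofFinite ι
  obtain ⟨j, hj, hmin⟩ := Finset.exists_min_image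
    (Finset.univ.filter fun j => S j ⊆ S i ∪ W ∧ (S j).card ≤ (S i).card)
    (fun j => (S j \ W).card) ⟨i, by simp⟩
  simp only [Finset.mem_filter, Finset.mem_univ, true_and] at hj hmin
  have hsub : S j ⊆ W ∪ (S j \ W) := by
    intro x hx; by_cases x ∈ W <;> simp_all
  have hT : S j \ W ⊆ S i := by
    intro x hx
    have h1 := Finset.mem_sdiff.1 hx
    have h2 := hj.1 h1.1
    simp_all
  obtain ⟨⟨l, hl⟩, hCZ, hcard⟩ := hC _ j hsub
  refine ⟨S j \ W, hT, ⟨j, rfl⟩, ?_, hcard.trans hj.2⟩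
  rw [hl] at hCZ hcard ⊢
  have hle := hmin l ⟨hCZ.trans (by
    rw [Finset.union_comm]; exact Finset.union_subset_union_left hT), hcard.trans hj.2⟩
  have hss : S l \ W ⊆ S j \ W := by
    intro x hx
    have h1 := Finset.mem_sdiff.1 hx
    have h2 := hCZ h1.1
    simp_all
  rw [← Finset.eq_of_subset_of_card_le hss hle]
  exact Finset.sdiff_subset

variable [Fintype α]

lemma weight_le_weight_union {p : ℝ} (h0 : 0 < p) (h1 : p ≤ 1) {W T : Finset α}
    (h : Disjoint W T) :
    weight p Finset.univ W ≤ weight p Finset.univ (W ∪ T) * (1 / p) ^ T.card := by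
  have hcard : (Finset.univ \ W).card = (Finset.univ \ (W ∪ T)).card + T.card := by
    rw [← Finset.card_union_of_disjoint]
    · congr 1
      ext x
      have hx : x ∈ W → x ∉ T := fun hW => Finset.disjoint_left.1 h hW
      simp only [Finset.mem_sdiff, Finset.mem_univ, true_and, Finset.mem_union]
      tauto
    · rw [Finset.disjoint_left]; intro x; simp
  rw [weight, weight, hcard, Finset.card_union_of_disjoint h]
  have e : p ^ (W.card + T.card) * (1 - p) ^ (Finset.univ \ (W ∪ T)).card * (1 / p) ^ T.card
      = p ^ W.card * (1 - p) ^ (Finset.univ \ (W ∪ T)).card := by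
    rw [pow_add, one_div, inv_pow]; field_simp
  rw [e, pow_add, ← mul_assoc]
  have h2 : 0 ≤ 1 - p := by linarith
  exact mul_le_of_le_one_right (mul_nonneg (pow_nonneg h0.le _) (pow_nonneg h2 _))
    (pow_le_one₀ h2 (by linarith))

variable [Fintype ι]

/-- A family of sets is `r`-spread, as a multiset. -/
def IsSpread (r : ℝ) (S : ι → Finset α) : Prop :=
  ∀ A : Finset α, ((Finset.univ.filter fun i => A ⊆ S i).card : ℝ) ≤
    (1 / r) ^ A.card * Fintype.card ι

omit [Fintype α] in
lemma IsSpread.mono {r : ℝ} {S T : ι → Finset α} (hS : IsSpread r S) (h : ∀ i, T i ⊆ S i) :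
    IsSpread r T := fun A => by
  refine le_trans ?_ (hS A)
  refine Nat.cast_le.2 (Finset.card_le_card fun i hi => ?_)
  simp only [Finset.mem_filter, Finset.mem_univ, true_and] at hi ⊢
  exact hi.trans (h i)

lemma sum_fragments_le {r p : ℝ} (h0 : 0 < p) (h1 : p ≤ 1) (hr : 4 ≤ r * p)
    {S : ι → Finset α} (hS : IsSpread r S) (C : Finset α → Finset α)
    (T : Finset α → ι → Finset α) (hTS : ∀ W i, T W i ⊆ S i)
    (hTW : ∀ W i, Disjoint W (T W i)) (hTC : ∀ W i, T W i ⊆ C (W ∪ T W i)) :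
    ∑ W, ∑ i, weight p Finset.univ W *
      (4 ^ (T W i).card * (1 / 2) ^ (C (W ∪ T W i)).card) ≤ (Fintype.card ι : ℝ) := by
  have hr0 : 0 < r := by
    by_contra h
    nlinarith
  have hw := weight_nonneg h0.le h1 (Finset.univ : Finset α)
  let g : Finset α → Finset α → ℝ := fun Z A =>
    weight p Finset.univ Z * (1 / p) ^ A.card * (4 ^ A.card * (1 / 2) ^ (C Z).card)
  have hg : ∀ Z A, 0 ≤ g Z A := fun Z A => by
    have := hw Z
    positivity
  let Q : Finset (Finset α × Finset α × ι) :=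
    Finset.univ.filter fun x => x.2.1 ⊆ C x.1 ∧ x.2.1 ⊆ S x.2.2
  let φ : Finset α × ι → Finset α × Finset α × ι :=
    fun x => (x.1 ∪ T x.1 x.2, T x.1 x.2, x.2)
  have hφ : Function.Injective φ := by
    rintro ⟨W, i⟩ ⟨W', i'⟩ h
    simp only [φ, Prod.mk.injEq] at h
    obtain ⟨hZ, hT, rfl⟩ := h
    have e : ∀ V, V = (V ∪ T V i) \ T V i := fun V => by
      rw [Finset.union_sdiff_right, Finset.sdiff_eq_self_of_disjoint (hTW V i)]
    rw [Prod.mk.injEq, e W, hZ, hT, ← e W']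
    exact ⟨rfl, rfl⟩
  calc ∑ W, ∑ i, weight p Finset.univ W *
        (4 ^ (T W i).card * (1 / 2) ^ (C (W ∪ T W i)).card)
      ≤ ∑ W, ∑ i, g (W ∪ T W i) (T W i) := by
        refine Finset.sum_le_sum fun W _ => Finset.sum_le_sum fun i _ => ?_
        exact mul_le_mul_of_nonneg_right (weight_le_weight_union h0 h1 (hTW W i)) (by positivity)
    _ = ∑ y ∈ (Finset.univ : Finset (Finset α × ι)).map ⟨φ, hφ⟩, g y.1 y.2.1 := by
        rw [Finset.sum_map, ← Fintype.sum_prod_type']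
        rfl
    _ ≤ ∑ y ∈ Q, g y.1 y.2.1 := by
        refine Finset.sum_le_sum_of_subset_of_nonneg ?_ fun y _ _ => hg _ _
        intro y hy
        obtain ⟨⟨W, i⟩, -, rfl⟩ := Finset.mem_map.1 hy
        exact Finset.mem_filter.2 ⟨Finset.mem_univ _, hTC W i, hTS W i⟩
    _ = ∑ Z, ∑ A ∈ (C Z).powerset,
          g Z A * ((Finset.univ.filter fun i => A ⊆ S i).card : ℝ) := by
        simp only [Q, Finset.sum_filter, Fintype.sum_prod_type]
        refine Finset.sum_congr rfl fun Z _ => ?_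
        rw [← Finset.sum_subset (Finset.subset_univ (C Z).powerset)]
        · refine Finset.sum_congr rfl fun A hA => ?_
          simp [Finset.mem_powerset.1 hA, ← Finset.sum_filter, mul_comm]
        · intro A _ hA
          simp [Finset.mem_powerset.not.1 hA]
    _ ≤ ∑ Z, ∑ A ∈ (C Z).powerset,
          weight p Finset.univ Z * (1 / 2) ^ (C Z).card * (Fintype.card ι : ℝ) := by
        refine Finset.sum_le_sum fun Z _ => Finset.sum_le_sum fun A _ => ?_
        have h4 : (1 / p) ^ A.card * 4 ^ A.card * (1 / r) ^ A.card ≤ 1 := by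
          rw [← mul_pow, ← mul_pow]
          refine pow_le_one₀ (by positivity) ?_
          rw [show 1 / p * 4 * (1 / r) = 4 / (r * p) by field_simp]
          exact (div_le_one (by positivity)).2 hr
        calc g Z A * _ ≤ g Z A * ((1 / r) ^ A.card * Fintype.card ι) :=
              mul_le_mul_of_nonneg_left (hS A) (hg Z A)
          _ = weight p Finset.univ Z * (1 / 2) ^ (C Z).card * (Fintype.card ι : ℝ) *
                ((1 / p) ^ A.card * 4 ^ A.card * (1 / r) ^ A.card) := by
              simp only [g]; ring
          _ ≤ _ := mul_le_of_le_one_right (by have := hw Z; positivity) h4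
    _ = ∑ Z, weight p Finset.univ Z * (Fintype.card ι : ℝ) := by
        refine Finset.sum_congr rfl fun Z _ => ?_
        rw [Finset.sum_const, Finset.card_powerset, nsmul_eq_mul]
        push_cast
        have : (2 : ℝ) ^ (C Z).card * (1 / 2) ^ (C Z).card = 1 := by
          rw [← mul_pow]; norm_num
        linear_combination weight p Finset.univ Z * (Fintype.card ι : ℝ) * this
    _ = Fintype.card ι := by
        simpa [expect] using expect_const p (Fintype.card ι : ℝ) (Finset.univ : Finset α)

lemma one_add_two_mul_sub_le (a b c : ℕ) (h : c ≤ b) :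
    1 + 2 * (a : ℝ) - b ≤ 4 ^ a * (1 / 2) ^ c := by
  have h1 : (1 / 2 : ℝ) ^ b ≤ (1 / 2) ^ c :=
    pow_le_pow_of_le_one (by norm_num) (by norm_num) h
  refine le_trans ?_ (mul_le_mul_of_nonneg_left h1 (by positivity))
  have h4 : (4 : ℝ) ^ a = 2 ^ (2 * a) := by rw [pow_mul]; norm_num
  rw [h4]
  rcases le_total b (2 * a) with hb | hb
  · obtain ⟨d, hd⟩ := Nat.exists_eq_add_of_le hb
    have h2 : (2 : ℝ) ^ (2 * a) * (1 / 2) ^ b = 2 ^ d := by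
      rw [hd, pow_add, mul_right_comm, ← mul_pow]; norm_num
    have h3 : (2 : ℝ) * a = b + d := by exact_mod_cast hd
    have h5 : (d : ℝ) + 1 ≤ 2 ^ d := by exact_mod_cast Nat.lt_two_pow_self (n := d)
    rw [h2]; linarith
  · rcases hb.eq_or_lt with hb | hb
    · have h3 : (2 : ℝ) * a = b := by exact_mod_cast hb
      rw [hb, ← mul_pow, h3]; norm_num
    · have h3 : (2 : ℝ) * a + 1 ≤ b := by exact_mod_cast hb
      have : (0 : ℝ) ≤ 2 ^ (2 * a) * (1 / 2) ^ b := by positivity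
      linarith

/-- One refinement step: in expectation over a `p`-random set `W`, passing to fragments outside
`W` halves the average size of a spread family. -/
lemma exists_fragments {r p : ℝ} (h0 : 0 < p) (h1 : p ≤ 1) (hr : 4 ≤ r * p)
    {S : ι → Finset α} (hS : IsSpread r S) :
    ∃ T : Finset α → ι → Finset α, (∀ W i, T W i ⊆ S i) ∧ (∀ W i, ∃ j, T W i = S j \ W) ∧
      expect p Finset.univ (fun W => ∑ i, ((T W i).card : ℝ)) ≤
        (∑ i, ((S i).card : ℝ)) / 2 := by
  choose C hC using exists_smallest_member S
  choose T hTS hTj hTC hcard using exists_min_fragment S C hC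
  refine ⟨T, hTS, hTj, ?_⟩
  have hTW : ∀ W i, Disjoint W (T W i) := fun W i => by
    obtain ⟨j, hj⟩ := hTj W i
    rw [hj]; exact Finset.disjoint_sdiff
  have key := sum_fragments_le h0 h1 hr hS C T hTS hTW hTC
  have hle : expect p Finset.univ (fun W => ((Fintype.card ι : ℝ) - ∑ i, ((S i).card : ℝ)) +
      2 * ∑ i, ((T W i).card : ℝ)) ≤ Fintype.card ι := by
    refine le_trans ?_ key
    rw [expect, Finset.powerset_univ]
    refine Finset.sum_le_sum fun W _ => ?_
    rw [← Finset.mul_sum]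
    refine mul_le_mul_of_nonneg_left ?_ (weight_nonneg h0.le h1 _ _)
    calc (Fintype.card ι : ℝ) - ∑ i, ((S i).card : ℝ) + 2 * ∑ i, ((T W i).card : ℝ)
        = ∑ i, (1 + 2 * ((T W i).card : ℝ) - (S i).card) := by
          simp [Finset.sum_sub_distrib, Finset.sum_add_distrib, Finset.mul_sum]; ring
      _ ≤ _ := Finset.sum_le_sum fun i _ => one_add_two_mul_sub_le _ _ _ (hcard W i)
  rw [expect_add, expect_const, expect_mul_left] at hle
  linarith

/-- The indicator of the event that `W` contains no member of the family `S`. -/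
noncomputable def missing (S : ι → Finset α) (W : Finset α) : ℝ :=
  if ∃ i, S i ⊆ W then 0 else 1

omit [Fintype α] in
lemma missing_le_average [Nonempty ι] (S : ι → Finset α) (W : Finset α) :
    missing S W ≤ (∑ i, ((S i).card : ℝ)) / Fintype.card ι := by
  unfold missing
  split_ifs with h
  · positivity
  · push Not at h
    rw [le_div_iff₀ (by exact_mod_cast Fintype.card_pos), one_mul]
    have : ∀ i, (1 : ℝ) ≤ (S i).card := fun i => by
      have : (S i).Nonempty := by
        rw [Finset.nonempty_iff_ne_empty]
        intro he
        exact h i (he ▸ Finset.empty_subset W)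
      exact_mod_cast this.card_pos
    simpa using Finset.sum_le_sum fun i (_ : i ∈ Finset.univ) => this i

omit [Fintype α] in
lemma missing_union_le {S T : ι → Finset α} {W : Finset α} (h : ∀ i, ∃ j, T i = S j \ W)
    (V : Finset α) : missing S (W ∪ V) ≤ missing T V := by
  unfold missing
  split_ifs with h1 h2 h2
  · exact le_rfl
  · exact zero_le_one
  · obtain ⟨i, hi⟩ := h2
    obtain ⟨j, hj⟩ := h i
    exact absurd ⟨j, sdiff_le_iff.1 (hj ▸ hi)⟩ h1
  · exact le_rfl

/-- A spread lemma: a random set of density `1 - (1 - p) ^ m * (1 - q)` misses every member of an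
`r`-spread family with probability at most `2 ^ (-m)` times the average size. -/
lemma expect_missing_le [Nonempty ι] {r p q : ℝ} (h0 : 0 < p) (h1 : p ≤ 1) (hr : 4 ≤ r * p)
    (hq0 : 0 ≤ q) (hq1 : q ≤ 1) (m : ℕ) {S : ι → Finset α} (hS : IsSpread r S) :
    expect (1 - (1 - p) ^ m * (1 - q)) Finset.univ (missing S) ≤
      (∑ i, ((S i).card : ℝ)) / Fintype.card ι * (1 / 2) ^ m := by
  induction m generalizing S with
  | zero =>
    simp only [pow_zero, one_mul, mul_one, sub_sub_cancel]
    exact (expect_mono hq0 hq1 _ (missing_le_average S)).trans_eq (expect_const _ _ _)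
  | succ m ih =>
    obtain ⟨T, hTS, hTj, hT⟩ := exists_fragments h0 h1 hr hS
    have hp : 0 ≤ 1 - p := by linarith
    have hp' : 0 ≤ (1 - p) ^ m * (1 - q) := mul_nonneg (pow_nonneg hp m) (by linarith)
    have hp'' : (1 - p) ^ m * (1 - q) ≤ 1 :=
      mul_le_one₀ (pow_le_one₀ hp (by linarith)) (by linarith) (by linarith)
    have e : 1 - (1 - p) ^ (m + 1) * (1 - q) =
        1 - (1 - p) * (1 - (1 - (1 - p) ^ m * (1 - q))) := by ring
    rw [e, ← expect_union]
    calc _ ≤ expect p Finset.univ fun W =>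
            ((1 / 2) ^ m / Fintype.card ι) * ∑ i, ((T W i).card : ℝ) := by
          refine expect_mono h0.le h1 _ fun W => ?_
          refine (expect_mono (by linarith) (by linarith) _ (missing_union_le (hTj W))).trans ?_
          refine (ih (hS.mono (hTS W))).trans_eq ?_
          ring
      _ ≤ ((1 / 2) ^ m / Fintype.card ι) * ((∑ i, ((S i).card : ℝ)) / 2) := by
          rw [expect_mul_left]
          exact mul_le_mul_of_nonneg_left hT (by positivity)
      _ = _ := by ring

lemma half_le_expect_missing {S : ι → Finset α} (hS : ∀ i j, (S i ∩ S j).Nonempty) :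
    1 / 2 ≤ expect (1 / 2) Finset.univ (missing S) := by
  have hw : ∀ W : Finset α, weight (1 / 2) Finset.univ Wᶜ = weight (1 / 2) Finset.univ W := by
    intro W
    simp only [weight, ← Finset.compl_eq_univ_sdiff, compl_compl]
    norm_num
    ring
  have hc : expect (1 / 2) Finset.univ (fun W => missing S Wᶜ) =
      expect (1 / 2) Finset.univ (missing S) := by
    simp only [expect, Finset.powerset_univ]
    refine Fintype.sum_equiv (Equiv.ofBijective compl compl_bijective) _ _ fun W => ?_
    rw [Equiv.ofBijective_apply, hw]
  have hsum : ∀ W, (1 : ℝ) ≤ missing S W + missing S Wᶜ := by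
    intro W
    unfold missing
    split_ifs with h1 h2 h2
    · obtain ⟨i, hi⟩ := h1
      obtain ⟨j, hj⟩ := h2
      obtain ⟨x, hx⟩ := hS i j
      have hx' := Finset.mem_inter.1 hx
      exact absurd (hi hx'.1) (Finset.mem_compl.1 (hj hx'.2))
    all_goals norm_num
  have := expect_mono (p := 1 / 2) (by norm_num) (by norm_num) (Finset.univ : Finset α) hsum
  rw [expect_const, expect_add, hc] at this
  linarith

/-- An `r`-spread family of nonempty sets of average size less than `2 ^ (m - 1)` is not
intersecting, if `m` rounds of `p`-random sets have union of density at most `1 / 2`. -/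
lemma not_intersecting_of_isSpread [Nonempty ι] {r p : ℝ} (h0 : 0 < p) (h1 : p ≤ 1)
    (hr : 4 ≤ r * p) {m k : ℕ} (hm : 1 / 2 ≤ (1 - p) ^ m) (hk : 2 * k < 2 ^ m)
    {S : ι → Finset α} (hS : IsSpread r S) (hcard : ∀ i, (S i).card = k) :
    ¬ ∀ i j, (S i ∩ S j).Nonempty := by
  intro hint
  have hpos : (0 : ℝ) < (1 - p) ^ m := by linarith
  have hq : 1 / (2 * (1 - p) ^ m) ≤ 1 := by
    rw [div_le_one (by positivity)]; linarith
  have hq' : 0 ≤ 1 / (2 * (1 - p) ^ m) := by positivity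
  have key := expect_missing_le (q := 1 - 1 / (2 * (1 - p) ^ m)) h0 h1 hr (by linarith)
    (by linarith) m hS
  have e : 1 - (1 - p) ^ m * (1 - (1 - 1 / (2 * (1 - p) ^ m))) = 1 / 2 := by
    field_simp; ring
  have hι : (Fintype.card ι : ℝ) ≠ 0 := by exact_mod_cast Fintype.card_ne_zero
  rw [e] at key
  simp only [hcard, Finset.sum_const, Finset.card_univ, nsmul_eq_mul] at key
  rw [mul_div_cancel_left₀ _ hι] at key
  have hlow := half_le_expect_missing hint
  have hk' : (2 * k : ℝ) < 2 ^ m := by exact_mod_cast hk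
  have h2 : (2 : ℝ) ^ m * (1 / 2) ^ m = 1 := by rw [← mul_pow]; norm_num
  have h3 : (0 : ℝ) < (1 / 2) ^ m := by positivity
  nlinarith

omit [Fintype α] in
/-- Some element of any member of an intersecting family of `k`-sets has relative degree at
least `1 / k`. -/
lemma card_le_of_isSpread [Nonempty ι] {r : ℝ} (hr : 0 < r) {k : ℕ}
    {S : ι → Finset α} (hS : IsSpread r S) (hcard : ∀ i, (S i).card = k)
    (hint : ∀ i j, (S i ∩ S j).Nonempty) : r ≤ k := by
  classical
  obtain ⟨i₀⟩ := ‹Nonempty ι›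
  have hcover : (Finset.univ : Finset ι) ⊆
      (S i₀).biUnion fun x => Finset.univ.filter fun i => {x} ⊆ S i := by
    intro i _
    obtain ⟨x, hx⟩ := hint i₀ i
    have hx' := Finset.mem_inter.1 hx
    simp only [Finset.mem_biUnion, Finset.mem_filter, Finset.mem_univ, true_and,
      Finset.singleton_subset_iff]
    exact ⟨x, hx'⟩
  have h1 : (Fintype.card ι : ℝ) ≤ ∑ x ∈ S i₀,
      ((Finset.univ.filter fun i => {x} ⊆ S i).card : ℝ) := by
    exact_mod_cast (Finset.card_le_card hcover).trans Finset.card_biUnion_le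
  have h2 := h1.trans (Finset.sum_le_sum fun x _ => hS {x})
  have hι : (0 : ℝ) < Fintype.card ι := by exact_mod_cast Fintype.card_pos_iff.2 ⟨i₀⟩
  simp only [Finset.card_singleton, pow_one, Finset.sum_const, hcard, nsmul_eq_mul] at h2
  rw [show (k : ℝ) * (1 / r * Fintype.card ι) = (k / r) * Fintype.card ι by ring] at h2
  have h3 : 1 ≤ (k : ℝ) / r := by
    by_contra h
    nlinarith
  rwa [one_le_div hr] at h3

lemma half_le_pow_of_logb {L : ℝ} (hL : 5 ≤ L) {m : ℕ} (hm : (m : ℝ) ≤ L + 1) :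
    1 / 2 ≤ (1 - 1 / (2 * L)) ^ m := by
  have hx : 0 < 1 - 1 / (2 * L) := by
    rw [sub_pos, div_lt_one (by linarith)]; linarith
  have hx' : (1 - 1 / (2 * L))⁻¹ = 2 * L / (2 * L - 1) := by
    have : 2 * L - 1 ≠ 0 := by linarith
    field_simp
  have hlog := Real.one_sub_inv_le_log_of_pos hx
  rw [hx'] at hlog
  have h2 : -(1 / (2 * L - 1)) ≤ Real.log (1 - 1 / (2 * L)) := by
    refine le_trans (le_of_eq ?_) hlog
    have : 2 * L - 1 ≠ 0 := by linarith
    field_simp; ring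
  have h3 : (m : ℝ) * (1 / (2 * L - 1)) ≤ 2 / 3 := by
    rw [mul_one_div, div_le_iff₀ (by linarith)]; linarith
  rw [← Real.log_le_log_iff (by norm_num) (by positivity), Real.log_pow, one_div, Real.log_inv]
  have := Real.log_two_gt_d9
  have := mul_le_mul_of_nonneg_left h2 (Nat.cast_nonneg (α := ℝ) m)
  linarith

end SpreadFamily

open SpreadFamily in
theorem intersecting_not_spread (n k : ℕ) (hk : 1 ≤ k)
    (F : Finset (Finset (Fin n))) (hkF : ∀ A ∈ F, A.card = k)
    (hne : F.Nonempty)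
    (hint : ∀ A ∈ F, ∀ B ∈ F, (A ∩ B).Nonempty)
    (δ : ℝ) (hδ : δ = 1 / (2 * Real.logb 2 (2 * k)))
    (H : ℝ) (hH : H = -δ * Real.logb 2 δ - (1 - δ) * Real.logb 2 (1 - δ))
    (r : ℝ) (hr : (2 : ℝ) ^ (2 * (1 + H)) / δ < r) :
    ∃ A : Finset (Fin n), A.Nonempty ∧
      r ^ (-(A.card : ℝ)) * F.card <
        (((F.filter (fun S => A ⊆ S)).image (fun S => S \ A)).card : ℝ) := by
  by_contra! hspread
  set L := Real.logb 2 (2 * k) with hLdef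
  have hk' : (1 : ℝ) ≤ k := by exact_mod_cast hk
  have hL_of : ∀ j : ℕ, (2 : ℝ) ^ j ≤ 2 * k → (j : ℝ) ≤ L := fun j hj => by
    rw [hLdef, Real.le_logb_iff_rpow_le (by norm_num) (by linarith), Real.rpow_natCast]
    exact hj
  have hL1 : 1 ≤ L := by simpa using hL_of 1 (by linarith)
  have hδ0 : 0 < δ := by rw [hδ]; positivity
  have hδ1 : δ ≤ 1 / 2 := by
    rw [hδ]; exact one_div_le_one_div_of_le (by norm_num) (by linarith)
  have hH0 : 0 ≤ H := by
    have h1 : Real.logb 2 δ ≤ 0 := Real.logb_nonpos (by norm_num) hδ0.le (by linarith)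
    have h2 : Real.logb 2 (1 - δ) ≤ 0 :=
      Real.logb_nonpos (by norm_num) (by linarith) (by linarith)
    rw [hH]; nlinarith
  have hpow : (4 : ℝ) ≤ 2 ^ (2 * (1 + H)) := by
    calc (4 : ℝ) = 2 ^ (2 : ℝ) := by norm_num
      _ ≤ _ := Real.rpow_le_rpow_of_exponent_le (by norm_num) (by linarith)
  have hrδ : 4 < r * δ := by
    rw [div_lt_iff₀ hδ0] at hr
    linarith
  have hr0 : 0 < r := by
    by_contra h
    nlinarith
  have hrL : 8 * L < r := by
    rw [hδ, mul_one_div, lt_div_iff₀ (by linarith)] at hrδ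
    linarith
  have : Nonempty F := hne.to_subtype
  have hS : IsSpread r (fun A : F => (A : Finset (Fin n))) := by
    intro A
    have hc : ((Finset.univ.filter fun i : F => A ⊆ (i : Finset (Fin n))).card) =
        ((F.filter (fun S => A ⊆ S)).image (fun S => S \ A)).card := by
      rw [Finset.card_image_of_injOn, ← Finset.card_map (Function.Embedding.subtype _)]
      · congr 1
        ext B
        simp
        tauto
      · intro B hB B' hB' h
        have h1 := (Finset.mem_filter.1 hB).2
        have h2 := (Finset.mem_filter.1 hB').2
        rw [← Finset.sdiff_union_of_subset h1, ← Finset.sdiff_union_of_subset h2]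
        exact congrArg (· ∪ A) h
    rcases A.eq_empty_or_nonempty with rfl | hA
    · simp
    · rw [hc, Fintype.card_coe, one_div, inv_pow, ← Real.rpow_natCast, ← Real.rpow_neg hr0.le]
      exact hspread A hA
  have hcard : ∀ A : F, (A : Finset (Fin n)).card = k := fun A => hkF A A.2
  have hint' : ∀ A B : F, ((A : Finset (Fin n)) ∩ B).Nonempty := fun A B => hint A A.2 B B.2
  rcases lt_or_ge k 16 with hk16 | hk16
  · have hrk := card_le_of_isSpread hr0 hS hcard hint'
    rcases lt_or_ge k 8 with hk8 | hk8
    · have : (k : ℝ) < 8 := by exact_mod_cast hk8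
      linarith
    · have h8 : (8 : ℝ) ≤ k := by exact_mod_cast hk8
      have h16 : (k : ℝ) < 16 := by exact_mod_cast hk16
      have := hL_of 4 (by linarith)
      norm_num at this
      linarith
  · have h16 : (16 : ℝ) ≤ k := by exact_mod_cast hk16
    have hL5 : 5 ≤ L := by simpa using hL_of 5 (by linarith)
    have hm : ((⌊L⌋₊ + 1 : ℕ) : ℝ) ≤ L + 1 := by
      push_cast
      linarith [Nat.floor_le (show 0 ≤ L by linarith)]
    have hhalf := half_le_pow_of_logb hL5 hm
    rw [← hδ] at hhalf
    have h2k : 2 * k < 2 ^ (⌊L⌋₊ + 1) := by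
      by_contra! h
      have h1 : (2 : ℝ) ^ (⌊L⌋₊ + 1) ≤ 2 * k := by exact_mod_cast h
      have h2 := hL_of _ h1
      push_cast at h2
      linarith [Nat.lt_floor_add_one L]
    exact not_intersecting_of_isSpread hδ0 (by linarith) hrδ.le hhalf h2k hS hcard hint'
end
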